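/- arXiv:2504.06556 — 10 statements merged into one kernel-verified Lean document; each statement's English description precedes it below -/
import Mathlib

section
/- For all integers n and d with 1 ≤ d ≤ n−2, the maximum size A(n,d) of an (n,d) tree-code satisfies A(n,d) ≤ n^(n−d)/(n−d+1). -/
/-- The tree-distance between two spanning trees on `Fin n`:
`d(T₁,T₂) = n - 1 - |E₁ ∩ E₂|`. -/
noncomputable def treeDist {n : ℕ} (G H : SimpleGraph (Fin n)) : ℕ :=
  n - 1 - (G.edgeSet ∩ H.edgeSet).ncard

/-- An `(n,d)` tree-code: a finite set of (spanning) trees on `Fin n`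
such that any two distinct members have tree-distance at least `d`. -/
def IsTreeCode (n d : ℕ) (C : Finset (SimpleGraph (Fin n))) : Prop :=
  (∀ G ∈ C, G.IsTree) ∧ ∀ G ∈ C, ∀ H ∈ C, G ≠ H → d ≤ treeDist G H

/-- `A n d`: the maximum size of an `(n,d)` tree-code. -/
noncomputable def A (n d : ℕ) : ℕ :=
  sSup {m : ℕ | ∃ C : Finset (SimpleGraph (Fin n)), IsTreeCode n d C ∧ C.card = m}

/-- An `(n,d;i)` tree-code: an `(n,d)` tree-code all of whose trees contain
a common set of at least `i` edges. -/
def IsTreeCodeCommon (n d i : ℕ) (C : Finset (SimpleGraph (Fin n))) : Prop :=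
  IsTreeCode n d C ∧
    ∃ E : Finset (Sym2 (Fin n)), i ≤ E.card ∧ ∀ G ∈ C, (E : Set (Sym2 (Fin n))) ⊆ G.edgeSet

/-- `Acommon n d i`: the maximum size of an `(n,d;i)` tree-code. -/
noncomputable def Acommon (n d i : ℕ) : ℕ :=
  sSup {m : ℕ | ∃ C : Finset (SimpleGraph (Fin n)), IsTreeCodeCommon n d i C ∧ C.card = m}

namespace RootedForest

open Finset

variable {V : Type*}

/-- `r` strictly decreases along the partial parent function `f`. -/
def IsRank (f : V → Option V) (r : V → ℕ) : Prop :=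
  ∀ v w, f v = some w → r w < r v

theorem exists_root {f : V → Option V} {r : V → ℕ} (hr : IsRank f r) (w : V) :
    ∃ u, f u = none ∧ ∀ r', IsRank f r' → r' u ≤ r' w := by
  induction h : r w using Nat.strong_induction_on generalizing w with
  | _ m ih =>
    cases hw : f w with
    | none => exact ⟨w, hw, fun _ _ => le_rfl⟩
    | some x =>
      obtain ⟨u, hu, hu'⟩ := ih (r x) (h ▸ hr w x hw) x rfl
      exact ⟨u, hu, fun r' hr' => (hu' r' hr').trans (hr' w x hw).le⟩

theorem IsRank.update_none [DecidableEq V] {f : V → Option V} {r : V → ℕ} (hr : IsRank f r) (v : V) :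
    IsRank (Function.update f v none) r := by
  intro a b h
  by_cases hav : a = v
  · simp [hav] at h
  · exact hr a b (by simpa [hav] using h)

variable [Fintype V]

/-- The non-root vertices of a partial parent function. -/
def nonroots (f : V → Option V) : Finset V := {v | f v ≠ none}

@[simp]
theorem mem_nonroots {f : V → Option V} {v : V} : v ∈ nonroots f ↔ f v ≠ none := by
  simp [nonroots]

variable [DecidableEq V]

/-- The edges joining a vertex to its parent. -/
def edges (f : V → Option V) : Finset (Sym2 V) :=
  {e | ∃ v w, f v = some w ∧ s(v, w) = e}

theorem mem_edges {f : V → Option V} {e : Sym2 V} :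
    e ∈ edges f ↔ ∃ v w, f v = some w ∧ s(v, w) = e := by
  simp [edges]

theorem card_edges {f : V → Option V} {r : V → ℕ} (hr : IsRank f r) :
    #(edges f) = #(nonroots f) := by
  symm
  refine card_bij (fun v _ => s(v, (f v).getD v)) ?_ ?_ ?_
  · intro v hv
    obtain ⟨w, hw⟩ := Option.ne_none_iff_exists'.1 (mem_nonroots.1 hv)
    exact mem_edges.2 ⟨v, w, hw, by simp [hw]⟩
  · intro v hv v' hv' h
    obtain ⟨w, hw⟩ := Option.ne_none_iff_exists'.1 (mem_nonroots.1 hv)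
    obtain ⟨w', hw'⟩ := Option.ne_none_iff_exists'.1 (mem_nonroots.1 hv')
    have h₁ := hr _ _ hw
    have h₂ := hr _ _ hw'
    simp only [hw, hw', Option.getD_some, Sym2.eq_iff] at h
    rcases h with h | ⟨rfl, rfl⟩
    · exact h.1
    · omega
  · intro e he
    obtain ⟨v, w, hw, rfl⟩ := mem_edges.1 he
    exact ⟨v, by simp [hw], by simp [hw]⟩

variable (V) in
open scoped Classical in
/-- Rooted forests on `V` with `k` edges, encoded by their parent functions. -/
noncomputable def rootedForests (k : ℕ) : Finset (V → Option V) :=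
  {f | (∃ r, IsRank f r) ∧ #(nonroots f) = k}

theorem mem_rootedForests {k : ℕ} {f : V → Option V} :
    f ∈ rootedForests V k ↔ (∃ r, IsRank f r) ∧ #(nonroots f) = k := by
  simp [rootedForests]

theorem nonroots_update_none (f : V → Option V) (v : V) :
    nonroots (Function.update f v none) = (nonroots f).erase v := by
  ext a
  by_cases hav : a = v <;> simp [hav]

/-- A rooted forest with `k + 1` edges and one of its edges can be recovered from the forest with
that edge deleted and the endpoints of the edge. -/
theorem card_rootedForests_succ (k : ℕ) :
    #(rootedForests V (k + 1)) * (k + 1) ≤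
      #(rootedForests V k) * (Fintype.card V * (Fintype.card V - 1 - k)) := by
  classical
  have hroot : ∀ f : V → Option V, ∀ w : V, ∃ u, f ∈ rootedForests V k →
      f u = none ∧ ∀ r', IsRank f r' → r' u ≤ r' w := by
    intro f w
    by_cases hf : f ∈ rootedForests V k
    · obtain ⟨r, hr⟩ := (mem_rootedForests.1 hf).1
      obtain ⟨u, hu⟩ := exists_root hr w
      exact ⟨u, fun _ => hu⟩
    · exact ⟨w, fun h => absurd h hf⟩
  choose root hroot using hroot
  let source := (rootedForests V (k + 1)).sigma fun f => nonroots f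
  let target := (rootedForests V k).sigma fun f =>
    (univ : Finset V).sigma fun w => (nonroots f)ᶜ.erase (root f w)
  have hsource : #source = #(rootedForests V (k + 1)) * (k + 1) := by
    rw [card_sigma, sum_const_nat fun f hf => (mem_rootedForests.1 hf).2]
  have htarget : #target =
      #(rootedForests V k) * (Fintype.card V * (Fintype.card V - 1 - k)) := by
    rw [card_sigma]
    refine sum_const_nat fun f hf => ?_
    rw [card_sigma, sum_const_nat (m := Fintype.card V - 1 - k), card_univ]
    intro w _
    rw [card_erase_of_mem (by simpa using (hroot f w hf).1), card_compl,
      (mem_rootedForests.1 hf).2]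
    omega
  rw [← hsource, ← htarget]
  refine card_le_card_of_injOn
    (fun x => ⟨Function.update x.1 x.2 none, (x.1 x.2).getD x.2, x.2⟩) ?_ ?_
  · rintro ⟨f, v⟩ hx
    obtain ⟨hf, hv⟩ := mem_sigma.1 (mem_coe.1 hx)
    obtain ⟨⟨r, hr⟩, hcard⟩ := mem_rootedForests.1 hf
    obtain ⟨w, hw⟩ := Option.ne_none_iff_exists'.1 (mem_nonroots.1 hv)
    have hf' : Function.update f v none ∈ rootedForests V k := by
      refine mem_rootedForests.2 ⟨⟨r, hr.update_none v⟩, ?_⟩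
      rw [nonroots_update_none, card_erase_of_mem hv, hcard, Nat.add_sub_cancel]
    refine mem_coe.2 (mem_sigma.2 ⟨hf', mem_sigma.2 ⟨mem_univ _, mem_erase.2 ⟨?_, ?_⟩⟩⟩)
    · dsimp only at hw
      intro h
      have h₁ := (hroot _ w hf').2 r (hr.update_none v)
      have h₂ := hr v w hw
      simp only [hw, Option.getD_some] at h
      rw [← h] at h₁
      omega
    · simp
  · rintro ⟨f, v⟩ hx ⟨f', v'⟩ hx' h
    obtain ⟨hf, hv⟩ := mem_sigma.1 (mem_coe.1 hx)
    obtain ⟨hf', hv'⟩ := mem_sigma.1 (mem_coe.1 hx')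
    obtain ⟨w, hw⟩ := Option.ne_none_iff_exists'.1 (mem_nonroots.1 hv)
    obtain ⟨w', hw'⟩ := Option.ne_none_iff_exists'.1 (mem_nonroots.1 hv')
    dsimp only at hw hw'
    simp only [hw, hw', Option.getD_some, Sigma.mk.injEq, heq_eq_eq] at h
    obtain ⟨h, rfl, rfl⟩ := h
    have : f = f' := by
      funext a
      by_cases ha : a = v
      · rw [ha, hw, hw']
      · simpa [ha] using congrFun h a
    rw [this]

theorem card_rootedForests_le (k : ℕ) :
    #(rootedForests V k) ≤ (Fintype.card V - 1).choose k * Fintype.card V ^ k := by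
  induction k with
  | zero =>
    simp only [Nat.choose_zero_right, pow_zero, mul_one]
    refine card_le_one.2 fun f hf g hg => ?_
    have hnone : ∀ f ∈ rootedForests V 0, ∀ v, f v = none := by
      intro f hf v
      have := card_eq_zero.1 (mem_rootedForests.1 hf).2
      by_contra hv
      simpa [this] using mem_nonroots.2 hv
    funext v
    rw [hnone f hf, hnone g hg]
  | succ k ih =>
    refine Nat.le_of_mul_le_mul_right ?_ k.succ_pos
    calc #(rootedForests V (k + 1)) * (k + 1)
        ≤ #(rootedForests V k) * (Fintype.card V * (Fintype.card V - 1 - k)) :=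
          card_rootedForests_succ k
      _ ≤ (Fintype.card V - 1).choose k * Fintype.card V ^ k *
          (Fintype.card V * (Fintype.card V - 1 - k)) := Nat.mul_le_mul_right _ ih
      _ = (Fintype.card V - 1).choose k * (Fintype.card V - 1 - k) *
          Fintype.card V ^ (k + 1) := by ring
      _ = (Fintype.card V - 1).choose (k + 1) * Fintype.card V ^ (k + 1) * (k + 1) := by
          rw [← Nat.choose_succ_right_eq]; ring

end RootedForest

namespace SimpleGraph.IsTree

variable {V : Type*} {G : SimpleGraph V}

/-- If `x` lies on the `v`-side and `y` on the `w`-side of an edge `vw` of a tree, then the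
geodesic from `x` to `y` runs through that edge. -/
theorem dist_eq_of_separated (hG : G.IsTree) {x y v w : V} (hvw : G.Adj v w)
    (hx : G.dist x w = G.dist x v + 1) (hy : G.dist v y = G.dist w y + 1) :
    G.dist x y = G.dist x v + 1 + G.dist w y := by
  classical
  obtain ⟨p, hp⟩ := hG.connected.exists_walk_length_eq_dist x v
  obtain ⟨q, hq⟩ := hG.connected.exists_walk_length_eq_dist w y
  obtain ⟨t, ht⟩ := hG.connected.exists_walk_length_eq_dist x y
  have hbridge := isAcyclic_iff_forall_adj_isBridge.1 hG.isAcyclic hvw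
  have hmem := isBridge_iff_forall_walk_mem_edges.1 hbridge
    (p.reverse.append (t.append q.reverse))
  simp only [Walk.edges_append, Walk.edges_reverse, List.mem_append, List.mem_reverse] at hmem
  rcases hmem with h | h | h
  · have hw := p.snd_mem_support_of_mem_edges h
    have h₁ := dist_le (p.takeUntil w hw)
    have h₂ := p.length_takeUntil_le_length hw
    omega
  · have hv := t.fst_mem_support_of_mem_edges h
    have h₁ := dist_le (t.takeUntil v hv)
    have h₂ := dist_le (t.dropUntil v hv)
    have h₃ := congrArg Walk.length (t.take_spec hv)
    rw [Walk.length_append] at h₃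
    have h₄ := hG.connected.dist_triangle (u := x) (v := v) (w := y)
    omega
  · have hv := q.fst_mem_support_of_mem_edges h
    have h₁ := dist_le (q.dropUntil v hv)
    have h₂ := q.length_dropUntil_le_length hv
    omega

/-- In a tree a vertex has at most one neighbour closer to a given vertex. -/
theorem eq_of_adj_of_dist_lt (hG : G.IsTree) {z v w w' : V} (hw : G.Adj v w) (hw' : G.Adj v w')
    (h : G.dist z w < G.dist z v) (h' : G.dist z w' < G.dist z v) : w = w' := by
  by_contra hne
  have h₁ := hG.dist_eq_dist_add_one_of_adj z hw
  have h₂ := hG.dist_eq_dist_add_one_of_adj z hw'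
  have h₃ := hG.dist_eq_dist_add_one_of_adj w' hw
  have h₄ := dist_eq_one_iff_adj.2 hw'.symm
  have h₅ := hG.connected.pos_dist_of_ne (Ne.symm hne)
  have h₆ := hG.dist_eq_of_separated (x := w') (y := z) hw (by omega)
    (by rw [dist_comm, dist_comm (u := w)]; omega)
  rw [dist_comm, dist_comm (u := w)] at h₆
  omega

/-- A neighbour of `v` closer to `z` is also closer to every `x ≠ v` no farther from `z`
than `v`. -/
theorem dist_lt_of_dist_le (hG : G.IsTree) {z v w x : V} (hw : G.Adj v w)
    (h : G.dist z w < G.dist z v) (hxv : x ≠ v) (hx : G.dist z x ≤ G.dist z v) :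
    G.dist x w < G.dist x v := by
  by_contra hlt
  have h₁ := hG.dist_eq_dist_add_one_of_adj z hw
  have h₂ := hG.dist_eq_dist_add_one_of_adj x hw
  have h₃ := hG.connected.pos_dist_of_ne hxv
  have h₄ := hG.dist_eq_of_separated (x := x) (y := z) hw (by omega)
    (by rw [dist_comm, dist_comm (u := w)]; omega)
  rw [dist_comm, dist_comm (u := w)] at h₄
  omega

end SimpleGraph.IsTree

namespace RootedForest

open Finset

variable {V : Type*} {G : SimpleGraph V}

open scoped Classical in
/-- The parent function orienting the edges in `S` towards `z`. -/
noncomputable def orient (G : SimpleGraph V) (S : Finset (Sym2 V)) (z v : V) : Option V :=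
  if h : ∃ w, s(v, w) ∈ S ∧ G.dist z w < G.dist z v then some h.choose else none

theorem orient_eq_some (hG : G.IsTree) {S : Finset (Sym2 V)} (hS : (S : Set (Sym2 V)) ⊆ G.edgeSet)
    {z v w : V} :
    orient G S z v = some w ↔ s(v, w) ∈ S ∧ G.dist z w < G.dist z v := by
  unfold orient
  split_ifs with h
  · obtain ⟨h₁, h₂⟩ := h.choose_spec
    rw [Option.some_inj]
    refine ⟨fun hw => hw ▸ ⟨h₁, h₂⟩, fun hw => ?_⟩
    exact hG.eq_of_adj_of_dist_lt (hS h₁) (hS hw.1) h₂ hw.2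
  · simpa using fun hw => not_lt.1 fun hlt => h ⟨w, hw, hlt⟩

theorem isRank_orient (hG : G.IsTree) {S : Finset (Sym2 V)}
    (hS : (S : Set (Sym2 V)) ⊆ G.edgeSet) (z : V) : IsRank (orient G S z) (G.dist z) :=
  fun _ _ h => ((orient_eq_some hG hS).1 h).2

theorem orient_self (hG : G.IsTree) {S : Finset (Sym2 V)}
    (hS : (S : Set (Sym2 V)) ⊆ G.edgeSet) (z : V) : orient G S z z = none := by
  rw [Option.eq_none_iff_forall_ne_some]
  intro w hw
  simpa using isRank_orient hG hS z z w hw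

variable [Fintype V] [DecidableEq V]

theorem edges_orient (hG : G.IsTree) {S : Finset (Sym2 V)}
    (hS : (S : Set (Sym2 V)) ⊆ G.edgeSet) (z : V) : edges (orient G S z) = S := by
  ext e
  rw [mem_edges]
  constructor
  · rintro ⟨v, w, h, rfl⟩
    exact ((orient_eq_some hG hS).1 h).1
  · intro he
    induction e using Sym2.ind with
    | _ v w =>
      rcases lt_or_gt_of_ne (hG.dist_ne_of_adj z (hS he)) with h | h
      · exact ⟨w, v, (orient_eq_some hG hS).2 ⟨Sym2.eq_swap ▸ he, h⟩, Sym2.eq_swap⟩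
      · exact ⟨v, w, (orient_eq_some hG hS).2 ⟨he, h⟩, rfl⟩

/-- A forest with `k` edges contained in a tree has at least `k + 1` rootings. -/
theorem succ_card_le_card_rootings (hG : G.IsTree) {S : Finset (Sym2 V)}
    (hS : (S : Set (Sym2 V)) ⊆ G.edgeSet) :
    #S + 1 ≤ #{f ∈ rootedForests V #S | edges f = S} := by
  obtain ⟨z⟩ := hG.connected.nonempty
  have hcard (x : V) : #(nonroots (orient G S x)) = #S := by
    rw [← card_edges (isRank_orient hG hS x), edges_orient hG hS]
  have hne {x y : V} (hx : x ∈ insert z (nonroots (orient G S z))) (hxy : x ≠ y)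
      (hle : G.dist z y ≤ G.dist z x) : orient G S x ≠ orient G S y := by
    intro h
    rcases mem_insert.1 hx with rfl | hx
    · rw [SimpleGraph.dist_self, Nat.le_zero, hG.connected.dist_eq_zero_iff] at hle
      exact hxy hle
    · obtain ⟨w, hw⟩ := Option.ne_none_iff_exists'.1 (mem_nonroots.1 hx)
      obtain ⟨hw, hlt⟩ := (orient_eq_some hG hS).1 hw
      have hy := (orient_eq_some hG hS).2
        ⟨hw, hG.dist_lt_of_dist_le (hS hw) hlt hxy.symm hle⟩
      rw [← h, orient_self hG hS] at hy
      simp at hy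
  have hz : z ∉ nonroots (orient G S z) := by simp [orient_self hG hS z]
  have hinsert := card_insert_of_notMem hz
  rw [hcard z] at hinsert
  rw [← hinsert]
  refine card_le_card_of_injOn (orient G S) ?_ ?_
  · intro x _
    exact mem_coe.2 <| mem_filter.2
      ⟨mem_rootedForests.2 ⟨⟨_, isRank_orient hG hS x⟩, hcard x⟩, edges_orient hG hS x⟩
  · intro x hx y hy h
    by_contra hxy
    rcases le_total (G.dist z y) (G.dist z x) with hle | hle
    · exact hne hx hxy hle h
    · exact hne hy (Ne.symm hxy) hle h.symm

open scoped Classical in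
/-- A tree contains many rooted forests with `k` edges. -/
theorem le_card_rootedForests_subset (hG : G.IsTree) (k : ℕ) :
    (Fintype.card V - 1).choose k * (k + 1) ≤
      #{f ∈ rootedForests V k | (edges f : Set (Sym2 V)) ⊆ G.edgeSet} := by
  have hmaps : Set.MapsTo edges
      (({f ∈ rootedForests V k | (edges f : Set (Sym2 V)) ⊆ G.edgeSet} : Finset _) :
        Set (V → Option V))
      (G.edgeFinset.powersetCard k : Set (Finset (Sym2 V))) := by
    intro f hf
    obtain ⟨hf, hsub⟩ := mem_filter.1 (mem_coe.1 hf)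
    obtain ⟨⟨r, hr⟩, hk⟩ := mem_rootedForests.1 hf
    refine mem_coe.2 (mem_powersetCard.2 ⟨?_, (card_edges hr).trans hk⟩)
    rwa [← coe_subset, SimpleGraph.coe_edgeFinset]
  have hedges : #G.edgeFinset = Fintype.card V - 1 := by
    rw [← hG.card_edgeFinset, Nat.add_sub_cancel]
  rw [card_eq_sum_card_fiberwise hmaps, ← hedges, ← card_powersetCard, ← smul_eq_mul]
  refine card_nsmul_le_sum _ _ _ fun S hS => ?_
  obtain ⟨hsub, rfl⟩ := mem_powersetCard.1 hS
  have hS' : (S : Set (Sym2 V)) ⊆ G.edgeSet := by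
    rwa [← coe_subset, SimpleGraph.coe_edgeFinset] at hsub
  refine (succ_card_le_card_rootings hG hS').trans (card_le_card fun f hf => ?_)
  obtain ⟨hf, he⟩ := mem_filter.1 hf
  exact mem_filter.2 ⟨mem_filter.2 ⟨hf, he.symm ▸ hS'⟩, he⟩

end RootedForest

open Finset RootedForest in
theorem IsTreeCode.card_mul_le {n d : ℕ} (hd1 : 1 ≤ d) (hd2 : d ≤ n)
    {C : Finset (SimpleGraph (Fin n))} (hC : IsTreeCode n d C) :
    #C * (n - d + 1) ≤ n ^ (n - d) := by
  classical
  let contained (G : SimpleGraph (Fin n)) : Finset (Fin n → Option (Fin n)) :=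
    {f ∈ rootedForests (Fin n) (n - d) | (edges f : Set (Sym2 (Fin n))) ⊆ G.edgeSet}
  have hdisj : (C : Set (SimpleGraph (Fin n))).PairwiseDisjoint contained := by
    intro G hG H hH hne
    refine disjoint_left.2 fun f hfG hfH => ?_
    obtain ⟨hf, hsubG⟩ := mem_filter.1 hfG
    obtain ⟨-, hsubH⟩ := mem_filter.1 hfH
    obtain ⟨⟨r, hr⟩, hk⟩ := mem_rootedForests.1 hf
    have hdist := hC.2 G hG H hH hne
    have hcard := Set.ncard_le_ncard (Set.subset_inter hsubG hsubH) (Set.toFinite _)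
    rw [Set.ncard_coe_finset, card_edges hr, hk] at hcard
    unfold treeDist at hdist
    omega
  have hpos : 0 < (n - 1).choose (n - d) := Nat.choose_pos (by omega)
  refine Nat.le_of_mul_le_mul_left ?_ hpos
  calc (n - 1).choose (n - d) * (#C * (n - d + 1))
      = #C • ((n - 1).choose (n - d) * (n - d + 1)) := by rw [smul_eq_mul]; ring
    _ ≤ ∑ G ∈ C, #(contained G) := card_nsmul_le_sum _ _ _ fun G hG => by
        simpa using le_card_rootedForests_subset (hC.1 G hG) (n - d)
    _ = #(C.biUnion contained) := (card_biUnion hdisj).symm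
    _ ≤ #(rootedForests (Fin n) (n - d)) :=
        card_le_card (biUnion_subset.2 fun _ _ => filter_subset _ _)
    _ ≤ (n - 1).choose (n - d) * n ^ (n - d) := by
        simpa using card_rootedForests_le (V := Fin n) (n - d)

theorem stmt0 (n d : ℕ) (hd1 : 1 ≤ d) (hd2 : d ≤ n - 2) :
    (A n d : ℝ) ≤ (n : ℝ) ^ (n - d) / ((n : ℝ) - d + 1) := by
  have hA : A n d ≤ n ^ (n - d) / (n - d + 1) := by
    refine csSup_le ⟨0, ∅, by simp [IsTreeCode], rfl⟩ ?_
    rintro m ⟨C, hC, rfl⟩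
    exact (Nat.le_div_iff_mul_le (Nat.succ_pos _)).2 (hC.card_mul_le hd1 (by omega))
  rw [Nat.le_div_iff_mul_le (Nat.succ_pos _)] at hA
  have hcast : ((n : ℝ) - d + 1) = ((n - d + 1 : ℕ) : ℝ) := by
    rw [Nat.cast_add, Nat.cast_sub (by omega), Nat.cast_one]
  rw [hcast, le_div_iff₀ (by positivity)]
  exact_mod_cast hA
end

section
/- For integers n, d with 1 ≤ d ≤ n−2, one has A(n,d;n−d−2) ≥ [(d+2)(d+3)⋯(n−1) / C(n,2)^(n−d−2)] · A(n,d), where C(n,2) = n(n−1)/2. -/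
open Classical in
theorem exists_isTreeCode_card_eq_A {n d : ℕ} :
    ∃ C : Finset (SimpleGraph (Fin n)), IsTreeCode n d C ∧ C.card = A n d := by
  have hne : {m : ℕ | ∃ C : Finset (SimpleGraph (Fin n)), IsTreeCode n d C ∧ C.card = m}.Nonempty :=
    ⟨0, ∅, by simp [IsTreeCode]⟩
  refine Nat.sSup_mem hne ⟨Fintype.card (SimpleGraph (Fin n)), ?_⟩
  rintro _ ⟨C, -, rfl⟩
  exact C.card_le_univ

open Classical in
theorem IsTreeCodeCommon.card_le {n d i : ℕ} {C : Finset (SimpleGraph (Fin n))}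
    (hC : IsTreeCodeCommon n d i C) : C.card ≤ Acommon n d i := by
  refine le_csSup ⟨Fintype.card (SimpleGraph (Fin n)), ?_⟩ ⟨C, hC, rfl⟩
  rintro _ ⟨C, -, rfl⟩
  exact C.card_le_univ

open Classical in
/-- Double counting pairs of a `k`-set of edges of the complete graph and a tree of an optimal code
containing it. -/
theorem A_mul_choose_le (n d k : ℕ) :
    A n d * (n - 1).choose k ≤ (n.choose 2).choose k * Acommon n d k := by
  obtain ⟨C, hC, hcard⟩ := exists_isTreeCode_card_eq_A (n := n) (d := d)
  let S := (⊤ : SimpleGraph (Fin n)).edgeFinset.powersetCard k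
  have hS : S.card = (n.choose 2).choose k := by
    simp only [S, Finset.card_powersetCard, SimpleGraph.card_edgeFinset_top_eq_card_choose_two,
      Fintype.card_fin]
  rw [← hcard, ← hS]
  refine Finset.card_mul_le_card_mul (fun G E => E ⊆ G.edgeFinset) (fun G hG => ?_)
    (fun E hE => ?_)
  · have hsub : G.edgeFinset.powersetCard k ⊆ S.bipartiteAbove (fun G E => E ⊆ G.edgeFinset) G := by
      intro E hE
      rw [Finset.mem_powersetCard] at hE
      rw [Finset.mem_bipartiteAbove, Finset.mem_powersetCard]
      exact ⟨⟨hE.1.trans (SimpleGraph.edgeFinset_mono le_top), hE.2⟩, hE.1⟩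
    have htree := (hC.1 G hG).card_edgeFinset
    rw [Fintype.card_fin] at htree
    refine le_trans (le_of_eq ?_) (Finset.card_le_card hsub)
    rw [Finset.card_powersetCard]
    congr 1
    omega
  · refine IsTreeCodeCommon.card_le ⟨⟨fun G hG => ?_, fun G hG H hH => ?_⟩, E, ?_, fun G hG => ?_⟩
    · exact hC.1 G (Finset.mem_filter.mp hG).1
    · exact hC.2 G (Finset.mem_filter.mp hG).1 H (Finset.mem_filter.mp hH).1
    · exact (Finset.mem_powersetCard.mp hE).2.ge
    · have h : E ⊆ G.edgeFinset := (Finset.mem_filter.mp hG).2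
      rw [← Finset.coe_subset, SimpleGraph.coe_edgeFinset] at h
      exact h

theorem prod_Icc_eq_descFactorial (m k : ℕ) :
    ∏ j ∈ Finset.Icc (m + 1) (m + k), j = (m + k).descFactorial k := by
  rw [Nat.add_descFactorial_eq_ascFactorial, Nat.ascFactorial_eq_prod_range,
    ← Finset.Ico_add_one_right_eq_Icc, Finset.prod_Ico_eq_prod_range]
  congr 2
  omega

theorem stmt2 (n d : ℕ) (hd1 : 1 ≤ d) (hd2 : d ≤ n - 2) :
    ((∏ j ∈ Finset.Icc (d + 2) (n - 1), (j : ℝ)) / (n.choose 2 : ℝ) ^ (n - d - 2)) * (A n d : ℝ)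
      ≤ (Acommon n d (n - d - 2) : ℝ) := by
  obtain ⟨k, rfl⟩ : ∃ k, n = d + 2 + k := ⟨n - (d + 2), by omega⟩
  have hk : d + 2 + k - d - 2 = k := by omega
  have hn : d + 2 + k - 1 = d + 1 + k := by omega
  have hcount := A_mul_choose_le (d + 2 + k) d k
  rw [hk, hn] at *
  set N := (d + 2 + k).choose 2
  have hN : 0 < N := Nat.choose_pos (by omega)
  have hnat : (d + 1 + k).descFactorial k * A (d + 2 + k) d
      ≤ Acommon (d + 2 + k) d k * N ^ k := by
    calc (d + 1 + k).descFactorial k * A (d + 2 + k) d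
        = k.factorial * (A (d + 2 + k) d * (d + 1 + k).choose k) := by
          rw [Nat.descFactorial_eq_factorial_mul_choose]; ring
      _ ≤ k.factorial * (N.choose k * Acommon (d + 2 + k) d k) := by gcongr
      _ = Acommon (d + 2 + k) d k * N.descFactorial k := by
          rw [Nat.descFactorial_eq_factorial_mul_choose]; ring
      _ ≤ Acommon (d + 2 + k) d k * N ^ k := by
          gcongr
          exact Nat.descFactorial_le_pow N k
  rw [← prod_Icc_eq_descFactorial] at hnat
  rw [div_mul_eq_mul_div, div_le_iff₀ (by positivity)]
  have hreal := (Nat.cast_le (α := ℝ)).mpr hnat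
  rwa [Nat.cast_mul, Nat.cast_mul, Nat.cast_pow, Nat.cast_prod] at hreal
end

section
/- For all integers n, d with 1 ≤ d ≤ n−2, one has A(n,d;n−d−2) ≤ C(C(n,2),2) / C(d+1,2), where C(m,2) = m(m−1)/2. -/
/-- A family of `k`-subsets of `S`, pairwise sharing at most one element, has at most
`(|S| choose 2) / (k choose 2)` members. -/
theorem card_mul_choose_two_le_of_card_inter_le_one {ι α : Type*} [DecidableEq α]
    (C : Finset ι) (F : ι → Finset α) (S : Finset α) (k : ℕ)
    (hS : ∀ i ∈ C, F i ⊆ S) (hk : ∀ i ∈ C, (F i).card = k)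
    (hF : ∀ i ∈ C, ∀ j ∈ C, i ≠ j → (F i ∩ F j).card ≤ 1) :
    C.card * k.choose 2 ≤ S.card.choose 2 := by
  have hdisj : (C : Set ι).PairwiseDisjoint fun i => (F i).powersetCard 2 := by
    intro i hi j hj hij
    refine Finset.disjoint_left.2 fun p hpi hpj => ?_
    rw [Finset.mem_powersetCard] at hpi hpj
    have h := Finset.card_le_card (Finset.subset_inter hpi.1 hpj.1)
    have := hF i hi j hj hij
    omega
  have hsub : (C.biUnion fun i => (F i).powersetCard 2) ⊆ S.powersetCard 2 :=
    Finset.biUnion_subset.2 fun i hi => Finset.powersetCard_mono (hS i hi)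
  calc C.card * k.choose 2 = ∑ i ∈ C, ((F i).powersetCard 2).card := by
        rw [Finset.sum_const_nat fun i hi => by rw [Finset.card_powersetCard, hk i hi]]
    _ = (C.biUnion fun i => (F i).powersetCard 2).card := (Finset.card_biUnion hdisj).symm
    _ ≤ (S.powersetCard 2).card := Finset.card_le_card hsub
    _ = S.card.choose 2 := Finset.card_powersetCard _ _

theorem IsTreeCodeCommon.card_mul_choose_two_le {n d : ℕ} (hd1 : 1 ≤ d) (hd2 : d ≤ n - 2)
    {C : Finset (SimpleGraph (Fin n))} (hC : IsTreeCodeCommon n d (n - d - 2) C) :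
    C.card * (d + 1).choose 2 ≤ (n.choose 2).choose 2 := by
  classical
  obtain ⟨⟨htree, hdist⟩, E, hE, hEsub⟩ := hC
  obtain ⟨E', hE'E, hE'⟩ := Finset.exists_subset_card_eq hE
  have hsub : ∀ G ∈ C, E' ⊆ G.edgeFinset := fun G hG e he =>
    SimpleGraph.mem_edgeFinset.2 (hEsub G hG (hE'E he))
  have hcard : (⊤ : SimpleGraph (Fin n)).edgeFinset.card = n.choose 2 := by
    simpa using SimpleGraph.card_edgeFinset_top_eq_card_choose_two (V := Fin n)
  rw [← hcard]
  refine card_mul_choose_two_le_of_card_inter_le_one C (fun G => G.edgeFinset \ E') _ _ ?_ ?_ ?_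
  · intro G _
    exact Finset.sdiff_subset.trans (SimpleGraph.edgeFinset_mono le_top)
  · intro G hG
    have h := (htree G hG).card_edgeFinset
    rw [Fintype.card_fin] at h
    rw [Finset.card_sdiff_of_subset (hsub G hG)]
    omega
  · intro G hG H hH hGH
    have h := hdist G hG H hH hGH
    have hcoe : G.edgeSet ∩ H.edgeSet = ↑(G.edgeFinset ∩ H.edgeFinset) := by simp
    rw [treeDist, hcoe, Set.ncard_coe_finset] at h
    have hinter : (G.edgeFinset \ E') ∩ (H.edgeFinset \ E') =
        (G.edgeFinset ∩ H.edgeFinset) \ E' := inf_sdiff.symm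
    rw [hinter,
      Finset.card_sdiff_of_subset (Finset.subset_inter (hsub G hG) (hsub H hH))]
    omega

theorem stmt3 (n d : ℕ) (hd1 : 1 ≤ d) (hd2 : d ≤ n - 2) :
    (Acommon n d (n - d - 2) : ℝ) ≤ ((n.choose 2).choose 2 : ℝ) / ((d + 1).choose 2 : ℝ) := by
  have hpos : 0 < (d + 1).choose 2 := Nat.choose_pos (by omega)
  refine le_trans (Nat.cast_le.2 (csSup_le' ?_)) Nat.cast_div_le
  rintro m ⟨C, hC, rfl⟩
  exact (Nat.le_div_iff_mul_le hpos).2 (hC.card_mul_choose_two_le hd1 hd2)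
end

section
/- For integers n, d with 1 ≤ d ≤ n−2, if C(n,2) − (n−d−2) < (d+1)², then A(n,d;n−d−2) ≤ d·(C(n,2) − (n−d−2)) / ((d+1)² − (C(n,2) − (n−d−2))), where C(n,2) = n(n−1)/2. -/
/-- Second-moment (Johnson-type) bound: a family of `(d + 1)`-subsets of `U` whose pairwise
intersections have at most one element. -/
theorem card_mul_sq_le_of_card_inter_le_one {ι α : Type*} [DecidableEq α]
    (C : Finset ι) (F : ι → Finset α) (U : Finset α) (d : ℕ)
    (hU : ∀ c ∈ C, F c ⊆ U) (hF : ∀ c ∈ C, (F c).card = d + 1)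
    (hinter : ∀ c ∈ C, ∀ c' ∈ C, c ≠ c' → (F c ∩ F c').card ≤ 1) :
    C.card * (d + 1) ^ 2 ≤ U.card * (d + C.card) := by
  classical
  rcases C.card.eq_zero_or_pos with h0 | hpos
  · simp [h0]
  let deg : α → ℕ := fun e => ∑ c ∈ C, if e ∈ F c then 1 else 0
  have hsum : ∑ e ∈ U, deg e = C.card * (d + 1) := by
    simp only [deg]
    rw [Finset.sum_comm, Finset.sum_const_nat]
    intro c hc
    rw [← Finset.card_filter, Finset.filter_mem_eq_inter,
      Finset.inter_eq_right.mpr (hU c hc), hF c hc]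
  have hsq : ∑ e ∈ U, deg e ^ 2 = ∑ c ∈ C, ∑ c' ∈ C, (F c ∩ F c').card := by
    simp only [deg, sq, Finset.sum_mul_sum]
    rw [Finset.sum_comm]
    refine Finset.sum_congr rfl fun c hc => ?_
    rw [Finset.sum_comm]
    refine Finset.sum_congr rfl fun c' _ => ?_
    simp only [← ite_and, mul_ite, mul_one, mul_zero, ← Finset.mem_inter]
    rw [← Finset.card_filter, Finset.filter_mem_eq_inter, Finset.inter_eq_right.mpr,
      Finset.inter_comm]
    exact Finset.inter_subset_right.trans (hU c hc)
  have hrow : ∀ c ∈ C, ∑ c' ∈ C, (F c ∩ F c').card ≤ d + C.card := by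
    intro c hc
    have herase : ∑ c' ∈ C.erase c, (F c ∩ F c').card ≤ (C.erase c).card * 1 :=
      Finset.sum_le_card_nsmul _ _ _ fun c' hc' =>
        hinter c hc c' (Finset.mem_of_mem_erase hc') (Finset.ne_of_mem_erase hc').symm
    rw [← Finset.add_sum_erase C _ hc, Finset.inter_self, hF c hc]
    rw [Finset.card_erase_of_mem hc] at herase
    omega
  have hcs : (C.card * (d + 1)) ^ 2 ≤ U.card * (C.card * (d + C.card)) := by
    rw [← hsum]
    refine sq_sum_le_card_mul_sum_sq.trans (Nat.mul_le_mul_left _ ?_)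
    rw [hsq]
    exact Finset.sum_le_card_nsmul _ _ _ hrow
  refine Nat.le_of_mul_le_mul_left ?_ hpos
  calc C.card * (C.card * (d + 1) ^ 2) = (C.card * (d + 1)) ^ 2 := by ring
    _ ≤ U.card * (C.card * (d + C.card)) := hcs
    _ = C.card * (U.card * (d + C.card)) := by ring

theorem IsTreeCodeCommon.card_mul_sq_le {n d : ℕ} (hd1 : 1 ≤ d) (hd2 : d ≤ n - 2)
    {C : Finset (SimpleGraph (Fin n))} (hC : IsTreeCodeCommon n d (n - d - 2) C) :
    C.card * (d + 1) ^ 2 ≤ (n.choose 2 - (n - d - 2)) * (d + C.card) := by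
  classical
  obtain ⟨⟨htree, hdist⟩, E', hE', hsub'⟩ := hC
  obtain ⟨E, hEE', hE⟩ := Finset.exists_subset_card_eq hE'
  have hsub : ∀ G ∈ C, E ⊆ G.edgeFinset := fun G hG e he =>
    SimpleGraph.mem_edgeFinset.mpr (hsub' G hG (hEE' he))
  rcases C.eq_empty_or_nonempty with rfl | ⟨G₀, hG₀⟩
  · simp
  have htop : ∀ G : SimpleGraph (Fin n),
      G.edgeFinset ⊆ (⊤ : SimpleGraph (Fin n)).edgeFinset := fun G =>
    SimpleGraph.edgeFinset_mono le_top
  have hcardU : ((⊤ : SimpleGraph (Fin n)).edgeFinset \ E).card = n.choose 2 - (n - d - 2) := by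
    rw [Finset.card_sdiff_of_subset ((hsub G₀ hG₀).trans (htop G₀)), hE,
      SimpleGraph.card_edgeFinset_top_eq_card_choose_two, Fintype.card_fin]
  rw [← hcardU]
  refine card_mul_sq_le_of_card_inter_le_one C (fun G => G.edgeFinset \ E) _ d
    (fun G _ => Finset.sdiff_subset_sdiff (htop G) subset_rfl) (fun G hG => ?_)
    (fun G hG H hH hne => ?_)
  · have hcard := (htree G hG).card_edgeFinset
    rw [Fintype.card_fin] at hcard
    rw [Finset.card_sdiff_of_subset (hsub G hG), hE]
    omega
  · have hGH := hdist G hG H hH hne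
    have hcast : (G.edgeSet ∩ H.edgeSet).ncard = (G.edgeFinset ∩ H.edgeFinset).card := by
      rw [← Set.ncard_coe_finset, Finset.coe_inter, SimpleGraph.coe_edgeFinset,
        SimpleGraph.coe_edgeFinset]
    rw [treeDist, hcast] at hGH
    have hinter : (G.edgeFinset \ E) ∩ (H.edgeFinset \ E) =
        (G.edgeFinset ∩ H.edgeFinset) \ E := by
      ext e
      simp only [Finset.mem_inter, Finset.mem_sdiff]
      tauto
    rw [hinter, Finset.card_sdiff_of_subset (Finset.subset_inter (hsub G hG) (hsub H hH)), hE]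
    omega

theorem stmt4 (n d : ℕ) (hd1 : 1 ≤ d) (hd2 : d ≤ n - 2)
    (h : n.choose 2 - (n - d - 2) < (d + 1) ^ 2) :
    (Acommon n d (n - d - 2) : ℝ) ≤
      (d : ℝ) * ((n.choose 2 - (n - d - 2) : ℕ) : ℝ) /
        (((d : ℝ) + 1) ^ 2 - ((n.choose 2 - (n - d - 2) : ℕ) : ℝ)) := by
  obtain ⟨C, hC, hcard⟩ : Acommon n d (n - d - 2) ∈
      {m : ℕ | ∃ C, IsTreeCodeCommon n d (n - d - 2) C ∧ C.card = m} := by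
    refine Nat.sSup_mem ?_ ⟨Fintype.card (SimpleGraph (Fin n)), ?_⟩
    · have hle : n - d - 2 ≤ Fintype.card (Sym2 (Fin n)) := by
        rw [Sym2.card, Fintype.card_fin, Nat.choose_two_right, Nat.le_div_iff_mul_le two_pos]
        have : n * 2 ≤ (n + 1) * n := by nlinarith [show 3 ≤ n by omega]
        simp only [Nat.add_sub_cancel]
        omega
      obtain ⟨E, -, hE⟩ := Finset.exists_subset_card_eq (s := Finset.univ) hle
      exact ⟨0, ∅, ⟨⟨by simp, by simp⟩, E, hE.ge, by simp⟩, rfl⟩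
    · rintro m ⟨C, -, rfl⟩
      exact Finset.card_le_univ C
  have hbound := hC.card_mul_sq_le hd1 hd2
  rw [hcard] at hbound
  generalize n.choose 2 - (n - d - 2) = N at *
  have hN : (N : ℝ) < ((d : ℝ) + 1) ^ 2 := by exact_mod_cast h
  rw [le_div_iff₀ (sub_pos.mpr hN)]
  have hreal : (Acommon n d (n - d - 2) : ℝ) * ((d : ℝ) + 1) ^ 2 ≤
      N * (d + Acommon n d (n - d - 2)) := by exact_mod_cast hbound
  linarith
end

section
/- For every fixed integer θ ≥ 2, there exist a constant C > 0 and an integer N such that for all n ≥ N, A(n, n−θ) ≤ 2·(n/2)^(θ−1) + C·n^(θ−2). -/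
open Finset in
/-- Double counting of the pairs `(x, S)` with `x ∈ S ∈ F`. -/
theorem sum_card_filter_mem_eq {α : Type*} [Fintype α] [DecidableEq α] (F : Finset (Finset α)) :
    ∑ x, #{S ∈ F | x ∈ S} = ∑ S ∈ F, #S := by
  simp_rw [card_eq_sum_ones, sum_filter]
  rw [sum_comm]
  simp

open Finset in
/-- Double counting of the triples `(x, S, T)` with `x ∈ S ∩ T` and `S, T ∈ F`. -/
theorem sum_card_filter_mem_sq_eq {α : Type*} [Fintype α] [DecidableEq α]
    (F : Finset (Finset α)) :
    ∑ x, #{S ∈ F | x ∈ S} ^ 2 = ∑ S ∈ F, ∑ T ∈ F, #(S ∩ T) := by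
  have h : ∀ x, #{S ∈ F | x ∈ S} ^ 2 = ∑ S ∈ F, ∑ T ∈ F, if x ∈ S ∩ T then 1 else 0 := by
    intro x
    rw [card_filter, sq, sum_mul_sum]
    refine sum_congr rfl fun S _ => sum_congr rfl fun T _ => ?_
    by_cases hS : x ∈ S <;> by_cases hT : x ∈ T <;> simp [hS, hT]
  simp_rw [h]
  rw [sum_comm]
  refine sum_congr rfl fun S _ => ?_
  rw [sum_comm]
  refine sum_congr rfl fun T _ => ?_
  rw [sum_boole, filter_univ_mem, Nat.cast_id]

open Finset in
/-- Second-moment bound for `k`-uniform families whose members pairwise share at most one point. -/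
theorem card_mul_sq_le_of_card_inter_le_one_s6 {α : Type*} [Fintype α] [DecidableEq α]
    (F : Finset (Finset α)) (k : ℕ) (hk : ∀ S ∈ F, #S = k)
    (hF : ∀ S ∈ F, ∀ T ∈ F, S ≠ T → #(S ∩ T) ≤ 1) :
    #F * k ^ 2 ≤ Fintype.card α * (#F + k) := by
  rcases F.eq_empty_or_nonempty with rfl | hne
  · simp
  have hfirst : ∑ x, #{S ∈ F | x ∈ S} = #F * k := by
    rw [sum_card_filter_mem_eq, sum_congr rfl hk, sum_const, smul_eq_mul]
  have hsecond : ∑ x, #{S ∈ F | x ∈ S} ^ 2 ≤ #F * (#F + k) := by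
    rw [sum_card_filter_mem_sq_eq]
    refine (sum_le_card_nsmul F _ (#F + k) fun S hS => ?_).trans_eq (smul_eq_mul _ _)
    rw [← add_sum_erase F _ hS, inter_self, hk S hS, add_comm]
    have : ∑ T ∈ F.erase S, #(S ∩ T) ≤ #(F.erase S) * 1 :=
      sum_le_card_nsmul _ _ _ fun T hT =>
        hF S hS T (mem_of_mem_erase hT) (ne_of_mem_erase hT).symm
    have := card_erase_le (s := F) (a := S)
    lia
  have hcs := sq_sum_le_card_mul_sum_sq (s := (univ : Finset α)) (f := fun x => #{S ∈ F | x ∈ S})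
  rw [hfirst, card_univ] at hcs
  have hpos : 0 < #F := hne.card_pos
  refine Nat.le_of_mul_le_mul_left ?_ hpos
  calc #F * (#F * k ^ 2) = (#F * k) ^ 2 := by ring
    _ ≤ Fintype.card α * (#F * (#F + k)) := hcs.trans (Nat.mul_le_mul_left _ hsecond)
    _ = #F * (Fintype.card α * (#F + k)) := by ring

open Finset in
/-- A family of `(n - j)`-subsets of `Sym2 (Fin n)` whose members pairwise share at most `s + 1`
elements has at most `2 (n / 2) ^ (s + 1) + O(n ^ s)` members. -/
theorem exists_card_le_of_card_inter_le (s j : ℕ) :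
    ∃ C : ℝ, 0 < C ∧ ∃ N : ℕ, ∀ n : ℕ, N ≤ n → ∀ F : Finset (Finset (Sym2 (Fin n))),
      (∀ S ∈ F, #S + j = n) → (∀ S ∈ F, ∀ T ∈ F, S ≠ T → #(S ∩ T) ≤ s + 1) →
      (#F : ℝ) ≤ 2 * ((n : ℝ) / 2) ^ (s + 1) + C * (n : ℝ) ^ s := by
  have hcard : ∀ n : ℕ, (Fintype.card (Sym2 (Fin n)) : ℝ) = n * (n + 1) / 2 := by
    intro n
    rw [Sym2.card, Fintype.card_fin, Nat.cast_choose_two]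
    push_cast
    ring
  induction s generalizing j with
  | zero =>
    refine ⟨2 * (4 * j + 2), by positivity, 2 * (4 * j + 1), fun n hn F hk hF => ?_⟩
    have hle : j ≤ n := by lia
    have h := card_mul_sq_le_of_card_inter_le_one_s6 F (n - j) (fun S hS => by have := hk S hS; lia) hF
    have h' : (#F : ℝ) * (n - j) ^ 2 ≤ n * (n + 1) / 2 * (#F + (n - j)) := by
      rw [← hcard, ← Nat.cast_sub hle]
      exact_mod_cast h
    have hn' : 2 * (4 * (j : ℝ) + 1) ≤ n := by exact_mod_cast hn
    have hj : (0 : ℝ) ≤ j := j.cast_nonneg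
    have hM : (0 : ℝ) ≤ #F := Nat.cast_nonneg _
    have hnpos : (0 : ℝ) < n := by linarith
    have hcancel : (#F : ℝ) * (n - (4 * j + 1)) ≤ n * (n + 1) := by
      refine le_of_mul_le_mul_left ?_ hnpos
      nlinarith [mul_nonneg hM (sq_nonneg (j : ℝ)), mul_nonneg (mul_nonneg hnpos.le hnpos.le) hj,
        mul_nonneg hnpos.le hj]
    have hpos : (0 : ℝ) < n - (4 * j + 1) := by linarith
    have hmain : (#F : ℝ) ≤ n + 2 * (4 * j + 2) := by
      refine le_of_mul_le_mul_right (hcancel.trans ?_) hpos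
      nlinarith
    rw [zero_add, pow_one, pow_zero, mul_one]
    linarith
  | succ s ih =>
    obtain ⟨C, hC, N, h⟩ := ih (j + 1)
    refine ⟨C / 2 + (j + 1) * (2 + C), by positivity, N + 2 * j + 1, fun n hn F hk hF => ?_⟩
    have hle : j ≤ n := by lia
    have hlink : ∀ x, (#{S ∈ F | x ∈ S} : ℝ) ≤ 2 * ((n : ℝ) / 2) ^ (s + 1) + C * (n : ℝ) ^ s := by
      intro x
      have hinj : Set.InjOn (fun S : Finset (Sym2 (Fin n)) => S.erase x)
          (F.filter (x ∈ ·) : Finset (Finset (Sym2 (Fin n)))) := by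
        intro S hS T hT hST
        simp only [coe_filter, Set.mem_ofPred_eq] at hS hT
        rw [← insert_erase hS.2, ← insert_erase hT.2]
        exact congrArg (insert x) hST
      rw [← card_image_of_injOn hinj]
      refine h n (by lia) _ ?_ ?_
      · simp only [mem_image, mem_filter]
        rintro _ ⟨S, ⟨hS, hx⟩, rfl⟩
        have := card_erase_add_one hx
        have := hk S hS
        lia
      · simp only [mem_image, mem_filter]
        rintro _ ⟨S, ⟨hS, hxS⟩, rfl⟩ _ ⟨T, ⟨hT, hxT⟩, rfl⟩ hne
        have h1 := hF S hS T hT (fun h => hne (by rw [h]))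
        have h2 := card_erase_add_one (mem_inter.2 ⟨hxS, hxT⟩)
        rw [erase_inter, inter_erase, erase_idem]
        lia
    have hcount : (#F : ℝ) * (n - j) ≤
        n * (n + 1) / 2 * (2 * ((n : ℝ) / 2) ^ (s + 1) + C * (n : ℝ) ^ s) := by
      have hsum : ∑ x, #{S ∈ F | x ∈ S} = #F * (n - j) := by
        rw [sum_card_filter_mem_eq, sum_congr rfl (g := fun _ => n - j)
          (fun S hS => by have := hk S hS; lia), sum_const, smul_eq_mul]
      rw [← Nat.cast_sub hle, ← Nat.cast_mul, ← hsum, Nat.cast_sum, ← hcard, ← nsmul_eq_mul,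
        ← card_univ]
      exact sum_le_card_nsmul _ _ _ fun x _ => hlink x
    have hn' : 2 * (j : ℝ) + 1 ≤ n := by exact_mod_cast (by lia : 2 * j + 1 ≤ n)
    have hj : (0 : ℝ) ≤ j := j.cast_nonneg
    have hpos : (0 : ℝ) < n - j := by linarith
    have hn1 : (1 : ℝ) ≤ n := by linarith
    have hratio : (n : ℝ) * (n + 1) / 2 ≤ (n / 2 + (j + 1)) * (n - j) := by nlinarith
    set B : ℝ := 2 * ((n : ℝ) / 2) ^ (s + 1) + C * (n : ℝ) ^ s with hB
    have hB0 : 0 ≤ B := by positivity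
    have hBle : B ≤ (2 + C) * (n : ℝ) ^ (s + 1) := by
      have h1 : ((n : ℝ) / 2) ^ (s + 1) ≤ (n : ℝ) ^ (s + 1) := by gcongr; linarith
      have h2 : (n : ℝ) ^ s ≤ (n : ℝ) ^ (s + 1) := pow_le_pow_right₀ hn1 (by lia)
      nlinarith
    have hmain : (#F : ℝ) ≤ (n / 2 + (j + 1)) * B := by
      refine le_of_mul_le_mul_right ?_ hpos
      calc _ ≤ _ := hcount
        _ ≤ (n / 2 + (j + 1)) * (n - j) * B := by gcongr
        _ = _ := by ring
    calc (#F : ℝ) ≤ n / 2 * B + (j + 1) * B := by linarith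
      _ ≤ n / 2 * B + (j + 1) * ((2 + C) * (n : ℝ) ^ (s + 1)) := by gcongr
      _ = _ := by rw [hB]; ring

open Classical Finset in
/-- The trees of an `(n, n - θ)` tree-code pairwise share fewer than `θ` edges. -/
theorem IsTreeCode.card_edgeFinset_inter_lt {n θ : ℕ} (hn : θ < n)
    {C : Finset (SimpleGraph (Fin n))} (hC : IsTreeCode n (n - θ) C) {G H : SimpleGraph (Fin n)}
    (hG : G ∈ C) (hH : H ∈ C) (hne : G ≠ H) : #(G.edgeFinset ∩ H.edgeFinset) < θ := by
  have h := hC.2 G hG H hH hne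
  rw [treeDist, ← G.coe_edgeFinset, ← H.coe_edgeFinset, ← coe_inter, Set.ncard_coe_finset] at h
  lia

theorem stmt6 (θ : ℕ) (hθ : 2 ≤ θ) :
    ∃ C : ℝ, 0 < C ∧ ∃ N : ℕ, ∀ n : ℕ, N ≤ n →
      (A n (n - θ) : ℝ) ≤ 2 * ((n : ℝ) / 2) ^ (θ - 1) + C * (n : ℝ) ^ (θ - 2) := by
  classical
  obtain ⟨s, rfl⟩ := Nat.exists_eq_add_of_le' hθ
  obtain ⟨K, hK, N, h⟩ := exists_card_le_of_card_inter_le s 1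
  refine ⟨K, hK, N + s + 3, fun n hn => ?_⟩
  have hmem : A n (n - (s + 2)) ∈ {m : ℕ | ∃ C : Finset (SimpleGraph (Fin n)),
      IsTreeCode n (n - (s + 2)) C ∧ C.card = m} := by
    refine Nat.sSup_mem ⟨0, ∅, by simp [IsTreeCode], rfl⟩
      ⟨Fintype.card (SimpleGraph (Fin n)), ?_⟩
    rintro _ ⟨C, -, rfl⟩
    exact C.card_le_univ
  obtain ⟨C, hC, hcard⟩ := hmem
  have hinj : Function.Injective fun G : SimpleGraph (Fin n) => G.edgeFinset :=
    fun G H hGH => SimpleGraph.edgeFinset_inj.1 hGH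
  rw [← hcard, ← Finset.card_image_of_injective C hinj]
  refine h n (by lia) _ ?_ ?_
  · simp only [Finset.mem_image]
    rintro _ ⟨G, hG, rfl⟩
    simpa using (hC.1 G hG).card_edgeFinset
  · simp only [Finset.mem_image]
    rintro _ ⟨G, hG, rfl⟩ _ ⟨H, hH, rfl⟩ hne
    exact Nat.le_of_lt_succ
      (hC.card_edgeFinset_inter_lt (by lia) hG hH fun hGH => hne (by rw [hGH]))
end

section
/- For every function θ : ℕ → ℕ with θ(n) ≥ 2 for all n and θ(n)²/n → 0 as n → ∞, there exists N such that for all n ≥ N, A(n, n−θ(n)) ≤ 2.1·(n/2)^(θ(n)−1). -/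
section SetFamilies

variable {α : Type*} [DecidableEq α]

/-- Double counting of the incidences between a family of sets and its ground set. -/
lemma sum_card_filter_mem_eq_sum_card (U : Finset α) (F : Finset (Finset α))
    (hU : ∀ S ∈ F, S ⊆ U) :
    ∑ e ∈ U, (F.filter (e ∈ ·)).card = ∑ S ∈ F, S.card := by
  simp_rw [Finset.card_filter]
  rw [Finset.sum_comm]
  refine Finset.sum_congr rfl fun S hS => ?_
  rw [← Finset.card_filter, Finset.filter_mem_eq_inter, Finset.inter_eq_right.mpr (hU S hS)]

/-- The sum of the squared degrees counts the pairwise intersections. -/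
lemma sum_card_filter_mem_sq_eq_sum_card_inter (U : Finset α) (F : Finset (Finset α))
    (hU : ∀ S ∈ F, S ⊆ U) :
    ∑ e ∈ U, (F.filter (e ∈ ·)).card ^ 2 = ∑ S ∈ F, ∑ T ∈ F, (S ∩ T).card := by
  simp_rw [Finset.card_filter, sq, Finset.sum_mul_sum]
  rw [Finset.sum_comm]
  refine Finset.sum_congr rfl fun S hS => ?_
  rw [Finset.sum_comm]
  refine Finset.sum_congr rfl fun T _ => ?_
  simp_rw [ite_zero_mul_ite_zero, mul_one]
  rw [← Finset.card_filter]
  congr 1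
  ext e
  simp only [Finset.mem_filter, Finset.mem_inter, and_iff_right_iff_imp]
  exact fun h => hU S hS h.1

/-- A second-moment bound for families of `k`-sets pairwise sharing at most one element. -/
lemma card_mul_sq_sub_le_of_card_inter_le_one (U : Finset α) (F : Finset (Finset α)) (k : ℕ)
    (M : ℝ) (hM : (U.card : ℝ) ≤ M) (hU : ∀ S ∈ F, S ⊆ U) (hk : ∀ S ∈ F, S.card = k)
    (hF : ∀ S ∈ F, ∀ T ∈ F, S ≠ T → (S ∩ T).card ≤ 1) :
    (F.card : ℝ) * ((k : ℝ) ^ 2 - M) ≤ M * k := by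
  have hM0 : 0 ≤ M := (Nat.cast_nonneg _).trans hM
  have hsum : ∑ e ∈ U, (F.filter (e ∈ ·)).card = F.card * k := by
    rw [sum_card_filter_mem_eq_sum_card U F hU, Finset.sum_congr rfl hk]
    simp
  have hsq : ∑ e ∈ U, (F.filter (e ∈ ·)).card ^ 2 ≤ F.card * (k + F.card) := by
    rw [sum_card_filter_mem_sq_eq_sum_card_inter U F hU, ← smul_eq_mul]
    refine Finset.sum_le_card_nsmul _ _ _ fun S hS => ?_
    calc ∑ T ∈ F, (S ∩ T).card ≤ ∑ T ∈ F, ((if S = T then k else 0) + 1) := by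
          refine Finset.sum_le_sum fun T hT => ?_
          split_ifs with h
          · subst h
            simp [hk S hS]
          · simpa using hF S hS T hT h
      _ = k + F.card := by simp [Finset.sum_add_distrib, hS]
  have hcs := sq_sum_le_card_mul_sum_sq (s := U) (f := fun e => ((F.filter (e ∈ ·)).card : ℝ))
  have hsum' : ∑ e ∈ U, ((F.filter (e ∈ ·)).card : ℝ) = F.card * k := by exact_mod_cast hsum
  have hsq' : ∑ e ∈ U, ((F.filter (e ∈ ·)).card : ℝ) ^ 2 ≤ F.card * (k + F.card) := by
    exact_mod_cast hsq
  rw [hsum'] at hcs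
  have hbound : ((F.card : ℝ) * k) ^ 2 ≤ M * (F.card * (k + F.card)) :=
    hcs.trans (mul_le_mul hM hsq' (Finset.sum_nonneg fun _ _ => sq_nonneg _) hM0)
  rcases (Nat.cast_nonneg (α := ℝ) F.card).eq_or_lt with h0 | hpos
  · rw [← h0, zero_mul]
    positivity
  · refine le_of_mul_le_mul_left ?_ hpos
    linarith

/-- A Johnson-type bound for families of `(k + t)`-sets pairwise sharing at most `t + 1`
elements. -/
lemma card_le_of_card_inter_le (k : ℕ) (M : ℝ) (hk0 : 0 < k) (hkM : M < (k : ℝ) ^ 2) (t : ℕ)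
    (U : Finset α) (F : Finset (Finset α))
    (hM : (U.card : ℝ) ≤ M) (hU : ∀ S ∈ F, S ⊆ U) (hk : ∀ S ∈ F, S.card = k + t)
    (hF : ∀ S ∈ F, ∀ T ∈ F, S ≠ T → (S ∩ T).card ≤ t + 1) :
    (F.card : ℝ) ≤ (M / k) ^ t * (M * k / ((k : ℝ) ^ 2 - M)) := by
  have hM0 : 0 ≤ M := (Nat.cast_nonneg _).trans hM
  have hk0' : (0 : ℝ) < k := Nat.cast_pos.mpr hk0
  induction t generalizing F with
  | zero =>
    rw [pow_zero, one_mul, le_div_iff₀ (sub_pos.mpr hkM)]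
    exact card_mul_sq_sub_le_of_card_inter_le_one U F k M hM hU hk hF
  | succ t ih =>
    set B : ℝ := (M / k) ^ t * (M * k / ((k : ℝ) ^ 2 - M)) with hB
    have hB0 : 0 ≤ B := by
      have := sub_pos.mpr hkM
      positivity
    have hdeg : ∀ e ∈ U, ((F.filter (e ∈ ·)).card : ℝ) ≤ B := by
      intro e _
      have hinj : Set.InjOn (fun S : Finset α => S.erase e) (F.filter (e ∈ ·)) := by
        intro S hS T hT h
        simp only [Finset.coe_filter, Set.mem_ofPred_eq] at hS hT
        rw [← Finset.insert_erase hS.2, ← Finset.insert_erase hT.2]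
        exact congrArg _ h
      rw [← Finset.card_image_of_injOn hinj]
      apply ih
      · simp only [Finset.mem_image, Finset.mem_filter]
        rintro _ ⟨S, ⟨hS, -⟩, rfl⟩
        exact (Finset.erase_subset _ _).trans (hU S hS)
      · simp only [Finset.mem_image, Finset.mem_filter]
        rintro _ ⟨S, ⟨hS, he⟩, rfl⟩
        rw [Finset.card_erase_of_mem he, hk S hS]
        omega
      · simp only [Finset.mem_image, Finset.mem_filter]
        rintro _ ⟨S, ⟨hS, heS⟩, rfl⟩ _ ⟨T, ⟨hT, heT⟩, rfl⟩ hne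
        have hST := hF S hS T hT (fun h => hne (by rw [h]))
        rw [Finset.erase_inter, Finset.inter_erase, Finset.erase_idem,
          Finset.card_erase_of_mem (Finset.mem_inter.mpr ⟨heS, heT⟩)]
        omega
    have hsum : ∑ e ∈ U, ((F.filter (e ∈ ·)).card : ℝ) = F.card * (k + (t + 1)) := by
      have h := sum_card_filter_mem_eq_sum_card U F hU
      rw [Finset.sum_congr rfl hk, Finset.sum_const, smul_eq_mul] at h
      exact_mod_cast h
    have hle : (F.card : ℝ) * k ≤ M * B :=
      calc (F.card : ℝ) * k ≤ F.card * (k + (t + 1)) := by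
            gcongr
            have : (0 : ℝ) ≤ t := Nat.cast_nonneg t
            linarith
        _ ≤ U.card * B := by
            rw [← hsum, ← nsmul_eq_mul]
            exact Finset.sum_le_card_nsmul _ _ _ hdeg
        _ ≤ M * B := by gcongr
    rw [pow_succ', mul_assoc, ← hB, div_mul_eq_mul_div, le_div_iff₀ hk0']
    exact hle

end SetFamilies

/-- The size of a tree-code of distance `n - θ`, where `n = k + t + 1` and `θ = t + 2`. -/
lemma IsTreeCode.card_le {n k t : ℕ} (hn : n = k + t + 1) (hk0 : 1 < k)
    (hkn : (n : ℝ) ^ 2 / 2 < (k : ℝ) ^ 2) {C : Finset (SimpleGraph (Fin n))}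
    (hC : IsTreeCode n (n - (t + 2)) C) :
    (C.card : ℝ) ≤ ((n : ℝ) ^ 2 / 2 / k) ^ t *
      ((n : ℝ) ^ 2 / 2 * k / ((k : ℝ) ^ 2 - (n : ℝ) ^ 2 / 2)) := by
  classical
  have hinj : Function.Injective (fun G : SimpleGraph (Fin n) => G.edgeFinset) :=
    fun G H h => SimpleGraph.edgeFinset_inj.mp h
  rw [← Finset.card_image_of_injective C hinj]
  refine card_le_of_card_inter_le k _ (by omega) hkn t
    (⊤ : SimpleGraph (Fin n)).edgeFinset _ ?_ ?_ ?_ ?_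
  · rw [SimpleGraph.card_edgeFinset_top_eq_card_choose_two, Fintype.card_fin, Nat.cast_choose_two]
    have : (0 : ℝ) ≤ n := Nat.cast_nonneg n
    nlinarith
  · simp only [Finset.mem_image]
    rintro _ ⟨G, -, rfl⟩
    exact SimpleGraph.edgeFinset_mono le_top
  · simp only [Finset.mem_image]
    rintro _ ⟨G, hG, rfl⟩
    have h := (hC.1 G hG).card_edgeFinset
    rw [Fintype.card_fin] at h
    omega
  · simp only [Finset.mem_image]
    rintro _ ⟨G, hG, rfl⟩ _ ⟨H, hH, rfl⟩ hne
    have h := hC.2 G hG H hH (fun h => hne (by rw [h]))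
    have hcard : (G.edgeSet ∩ H.edgeSet).ncard = (G.edgeFinset ∩ H.edgeFinset).card := by
      rw [← Set.ncard_coe_finset]
      simp
    rw [treeDist, hcard] at h
    omega

/-- The Johnson-type bound is at most `2.1 * (n / 2) ^ (t + 1)` once `(t + 2) ^ 2` is small
compared to `n`. -/
lemma johnson_bound_le {n k t : ℕ} (hn : n = k + t + 1) (hk0 : 1 < k)
    (ht : ((t : ℝ) + 2) ^ 2 ≤ 0.005 * n) :
    ((n : ℝ) ^ 2 / 2 / k) ^ t * ((n : ℝ) ^ 2 / 2 * k / ((k : ℝ) ^ 2 - (n : ℝ) ^ 2 / 2)) ≤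
      2.1 * ((n : ℝ) / 2) ^ (t + 1) := by
  have hn0 : (0 : ℝ) < n := by
    have : 0 < n := by omega
    exact_mod_cast this
  have ht0 : (0 : ℝ) ≤ t := Nat.cast_nonneg t
  have hk0' : (0 : ℝ) < k := by
    have : 0 < k := by omega
    exact_mod_cast this
  have hn' : (n : ℝ) = k + t + 1 := by exact_mod_cast hn
  obtain ⟨r, hr⟩ : ∃ r : ℝ, (k : ℝ) = r * n := ⟨k / n, by field_simp⟩
  have hr0 : 0 < r := by
    by_contra! h
    nlinarith
  have hr1 : r ≤ 1 := by
    by_contra! h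
    nlinarith
  have hr2 : 0.995 ≤ r := by
    by_contra! h
    nlinarith
  have htr : (t : ℝ) * (1 - r) ≤ 0.005 := by
    by_contra! h
    nlinarith
  have hpow : 0.995 ≤ r ^ t := by
    have h := one_add_mul_le_pow (a := r - 1) (by linarith) t
    rw [add_sub_cancel] at h
    linarith
  have hden : 0.49 ≤ r ^ 2 - 1 / 2 := by nlinarith
  have hden0 : 0 < r ^ 2 - 1 / 2 := by linarith
  have h1 : (n : ℝ) ^ 2 / 2 / k = n / 2 * r⁻¹ := by
    rw [hr]
    field_simp
  have h2 : (n : ℝ) ^ 2 / 2 * k / ((k : ℝ) ^ 2 - (n : ℝ) ^ 2 / 2)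
      = n / 2 * (r / (r ^ 2 - 1 / 2)) := by
    have : (k : ℝ) ^ 2 - (n : ℝ) ^ 2 / 2 = (n : ℝ) ^ 2 * (r ^ 2 - 1 / 2) := by
      rw [hr]
      ring
    rw [this, hr]
    have := hden0.ne'
    generalize r ^ 2 - 1 / 2 = s at *
    field_simp
  rw [h1, h2, mul_pow, inv_pow]
  have hmain : (r ^ t)⁻¹ * (r / (r ^ 2 - 1 / 2)) ≤ 2.1 := by
    rw [inv_mul_eq_div, div_div, div_le_iff₀ (by positivity)]
    nlinarith [mul_le_mul hden hpow (by norm_num) hden0.le]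
  calc ((n : ℝ) / 2) ^ t * (r ^ t)⁻¹ * (n / 2 * (r / (r ^ 2 - 1 / 2)))
      = (r ^ t)⁻¹ * (r / (r ^ 2 - 1 / 2)) * ((n : ℝ) / 2) ^ (t + 1) := by ring
    _ ≤ 2.1 * ((n : ℝ) / 2) ^ (t + 1) := by gcongr

theorem stmt7 (θ : ℕ → ℕ) (hθ : ∀ n, 2 ≤ θ n)
    (hlim : Filter.Tendsto (fun n : ℕ => (θ n : ℝ) ^ 2 / (n : ℝ)) Filter.atTop (nhds 0)) :
    ∃ N : ℕ, ∀ n : ℕ, N ≤ n →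
      (A n (n - θ n) : ℝ) ≤ 2.1 * ((n : ℝ) / 2) ^ (θ n - 1) := by
  obtain ⟨N, hN⟩ := Filter.eventually_atTop.mp
    (hlim.eventually (gt_mem_nhds (show (0 : ℝ) < 0.005 by norm_num)))
  refine ⟨max N 1, fun n hn => ?_⟩
  have hn0 : (0 : ℝ) < n := by
    have : 0 < n := (le_max_right N 1).trans hn
    exact_mod_cast this
  have hsmall : (θ n : ℝ) ^ 2 ≤ 0.005 * n := by
    have := hN n ((le_max_left _ _).trans hn)
    rw [div_lt_iff₀ hn0] at this
    exact this.le
  obtain ⟨t, ht⟩ := Nat.exists_eq_add_of_le' (hθ n)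
  rw [ht] at hsmall ⊢
  push_cast at hsmall
  have ht0 : (0 : ℝ) ≤ t := Nat.cast_nonneg t
  have htn : t + 3 ≤ n := by
    have : (t : ℝ) + 3 ≤ n := by nlinarith
    exact_mod_cast this
  obtain ⟨k, hk⟩ : ∃ k, n = k + t + 1 := ⟨n - t - 1, by omega⟩
  have hk' : (n : ℝ) = k + t + 1 := by exact_mod_cast hk
  have hkn : (n : ℝ) ^ 2 / 2 < (k : ℝ) ^ 2 := by
    have : 0.99 * (n : ℝ) ≤ k := by nlinarith
    nlinarith
  have hne : {m : ℕ | ∃ C : Finset (SimpleGraph (Fin n)),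
      IsTreeCode n (n - (t + 2)) C ∧ C.card = m}.Nonempty :=
    ⟨0, ∅, by simp [IsTreeCode], rfl⟩
  have hbdd : BddAbove {m : ℕ | ∃ C : Finset (SimpleGraph (Fin n)),
      IsTreeCode n (n - (t + 2)) C ∧ C.card = m} := by
    classical
    refine ⟨Fintype.card (SimpleGraph (Fin n)), ?_⟩
    rintro _ ⟨C, -, rfl⟩
    exact Finset.card_le_univ C
  obtain ⟨C, hC, hcard⟩ := Nat.sSup_mem hne hbdd
  rw [A, ← hcard]
  exact (hC.card_le hk (by omega) hkn).trans (johnson_bound_le hk (by omega) hsmall)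
end

section
/- For all integers n ≥ 13, A(n, n−3; 1) ≤ n + 2. -/
/-- If `k`-subsets of `F`, indexed by `C`, pairwise share at most one element, then counting
incidences together with `r ^ 2 - 5 * r + 6 ≥ 0` for integers `r` bounds the size of `C`. -/
theorem card_mul_le_of_card_inter_le_one {ι α : Type*} [DecidableEq ι] [DecidableEq α]
    (C : Finset ι) (S : ι → Finset α) (F : Finset α) (k : ℕ) (hF : ∀ i ∈ C, S i ⊆ F)
    (hk : ∀ i ∈ C, (S i).card = k)
    (hS : ∀ i ∈ C, ∀ j ∈ C, i ≠ j → (S i ∩ S j).card ≤ 1) :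
    4 * (C.card : ℤ) * k ≤ C.card * (C.card - 1) + 6 * F.card := by
  set r : α → ℤ := fun f => ∑ i ∈ C, if f ∈ S i then 1 else 0 with hr
  have sum_r : ∑ f ∈ F, r f = C.card * k := by
    rw [hr, Finset.sum_comm, ← nsmul_eq_mul, ← Finset.sum_const]
    refine Finset.sum_congr rfl fun i hi => ?_
    rw [Finset.sum_boole, Finset.filter_mem_eq_inter, Finset.inter_eq_right.2 (hF i hi), hk i hi]
  have sum_sq : ∑ f ∈ F, r f * r f ≤ C.card * (k + (C.card - 1)) := by
    have expand : ∑ f ∈ F, r f * r f = ∑ i ∈ C, ∑ j ∈ C, ((S i ∩ S j).card : ℤ) := by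
      simp only [hr, Finset.sum_mul_sum]
      rw [Finset.sum_comm]
      refine Finset.sum_congr rfl fun i hi => ?_
      rw [Finset.sum_comm]
      refine Finset.sum_congr rfl fun j _ => ?_
      simp only [← ite_and, mul_ite, mul_one, mul_zero]
      rw [Finset.sum_boole]
      congr 2
      ext f
      have := @hF i hi f
      simp only [Finset.mem_filter, Finset.mem_inter]
      tauto
    rw [expand, ← nsmul_eq_mul, ← Finset.sum_const]
    refine Finset.sum_le_sum fun i hi => ?_
    rw [← Finset.add_sum_erase C _ hi, Finset.inter_self, hk i hi]
    have off : ∑ j ∈ C.erase i, ((S i ∩ S j).card : ℤ) ≤ ∑ _j ∈ C.erase i, (1 : ℤ) :=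
      Finset.sum_le_sum fun j hj => by
        exact_mod_cast hS i hi j (Finset.mem_of_mem_erase hj) (Finset.ne_of_mem_erase hj).symm
    rw [Finset.sum_const, Finset.card_erase_of_mem hi, nsmul_eq_mul, mul_one,
      Nat.cast_sub (Finset.card_pos.2 ⟨i, hi⟩), Nat.cast_one] at off
    linarith
  have convex : ∑ f ∈ F, (5 * r f - 6) ≤ ∑ f ∈ F, r f * r f :=
    Finset.sum_le_sum fun f _ => by
      rcases le_or_gt (r f) 2 with h | h <;> nlinarith
  rw [Finset.sum_sub_distrib, ← Finset.mul_sum, sum_r, Finset.sum_const, nsmul_eq_mul] at convex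
  linarith

theorem stmt8 (n : ℕ) (hn : 13 ≤ n) : Acommon n (n - 3) 1 ≤ n + 2 := by
  classical
  refine csSup_le' ?_
  rintro _ ⟨C, ⟨⟨htree, hdist⟩, E, hE, hcommon⟩, rfl⟩
  by_contra! hlarge
  obtain ⟨D, hDC, hD⟩ := Finset.exists_subset_card_eq (s := C) (n := n + 3) (by omega)
  obtain ⟨e, he⟩ := Finset.card_pos.1 hE
  have heG : ∀ G ∈ D, e ∈ G.edgeFinset := fun G hG =>
    SimpleGraph.mem_edgeFinset.2 (hcommon G (hDC hG) he)
  obtain ⟨G₀, hG₀⟩ := Finset.card_pos.1 (show 0 < D.card by omega)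
  have hetop : e ∈ (⊤ : SimpleGraph (Fin n)).edgeFinset :=
    SimpleGraph.edgeFinset_mono le_top (heG G₀ hG₀)
  have key := card_mul_le_of_card_inter_le_one D (fun G => G.edgeFinset.erase e)
    ((⊤ : SimpleGraph (Fin n)).edgeFinset.erase e) (n - 2)
    (fun G _ => Finset.erase_subset_erase e (SimpleGraph.edgeFinset_mono le_top))
    (fun G hG => by
      have hcard := (htree G (hDC hG)).card_edgeFinset
      rw [Fintype.card_fin] at hcard
      rw [Finset.card_erase_of_mem (heG G hG)]
      omega)
    (fun G hG H hH hne => by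
      have hd := hdist G (hDC hG) H (hDC hH) hne
      have hinter : (G.edgeSet ∩ H.edgeSet).ncard = (G.edgeFinset ∩ H.edgeFinset).card := by
        rw [← Set.ncard_coe_finset]
        simp
      rw [treeDist, hinter] at hd
      rw [Finset.erase_inter, Finset.inter_erase, Finset.erase_idem, Finset.card_erase_of_mem
        (Finset.mem_inter.2 ⟨heG G hG, heG H hH⟩)]
      omega)
  have hF : 2 * (((⊤ : SimpleGraph (Fin n)).edgeFinset.erase e).card : ℤ) = n * (n - 1) - 2 := by
    have hpos := Finset.card_pos.2 ⟨e, hetop⟩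
    rw [Finset.card_erase_of_mem hetop, Nat.cast_sub hpos,
      SimpleGraph.card_edgeFinset_top_eq_card_choose_two, Fintype.card_fin]
    have hchoose : (2 * n.choose 2 : ℤ) = n * (n - 1) := by
      have h := Nat.div_mul_cancel (Nat.even_mul_pred_self n).two_dvd
      rw [← Nat.choose_two_right] at h
      zify [show 1 ≤ n by omega] at h
      linarith
    push_cast
    linarith
  rw [hD] at key
  zify [show 2 ≤ n by omega] at key hn
  nlinarith
end

section
/- For all integers n ≥ 13, A(n, n−3) ≤ n(n+2)/2. -/
open Finset in
theorem sum_card_filter_mem {ι β : Type*} [DecidableEq β] (C : Finset ι) (E : ι → Finset β)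
    (U : Finset β) (hU : ∀ i ∈ C, E i ⊆ U) :
    ∑ f ∈ U, #{i ∈ C | f ∈ E i} = ∑ i ∈ C, #(E i) := by
  simp_rw [card_filter]
  rw [sum_comm]
  refine sum_congr rfl fun i hi => ?_
  rw [← card_filter, filter_mem_eq_inter, inter_eq_right.2 (hU i hi)]

open Finset in
/-- Integrality of the point degrees `r` of a set system, in the form `∑ (r - 2) (r - 3) ≥ 0`. -/
theorem five_mul_sum_card_le {ι β : Type*} [DecidableEq β] (C : Finset ι) (E : ι → Finset β)
    (U : Finset β) (hU : ∀ i ∈ C, E i ⊆ U) :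
    5 * ∑ i ∈ C, #(E i) ≤ ∑ i ∈ C, ∑ j ∈ C, #(E i ∩ E j) + 6 * #U := by
  have h2 : ∑ f ∈ U, #{i ∈ C | f ∈ E i} ^ 2 = ∑ i ∈ C, ∑ j ∈ C, #(E i ∩ E j) := by
    simp_rw [card_filter, sq, sum_mul_sum]
    rw [sum_comm]
    refine sum_congr rfl fun i hi => ?_
    rw [sum_comm]
    refine sum_congr rfl fun j _ => ?_
    simp_rw [ite_zero_mul_ite_zero, mul_one]
    rw [← card_filter]
    congr 1
    ext f
    simp only [mem_filter, mem_inter]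
    exact ⟨fun h => h.2, fun h => ⟨hU i hi h.1, h⟩⟩
  rw [← sum_card_filter_mem C E U hU, ← h2, mul_sum, mul_comm 6, ← smul_eq_mul (#U), ← sum_const, ← sum_add_distrib]
  refine sum_le_sum fun f _ => ?_
  generalize #{i ∈ C | f ∈ E i} = r
  rcases le_or_gt r 2 with h | h
  · interval_cases r <;> norm_num
  · nlinarith

open Finset in
/-- A family of `(n - 2)`-sets in a universe of size `(n - 2) (n + 1) / 2`
that pairwise meet in at most one point has at most `n + 2` members. -/
theorem card_le_of_pairwise_card_inter_le_one {ι β : Type*} [DecidableEq β] {n : ℕ} (hn : 13 ≤ n)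
    (C : Finset ι) (E : ι → Finset β) (U : Finset β) (hU : ∀ i ∈ C, E i ⊆ U)
    (hcard : ∀ i ∈ C, #(E i) + 2 = n) (hUcard : 2 * (#U + 1) = n * (n - 1))
    (hinter : ∀ i ∈ C, ∀ j ∈ C, i ≠ j → #(E i ∩ E j) ≤ 1) :
    #C ≤ n + 2 := by
  classical
  by_contra! hC
  obtain ⟨D, hDC, hD⟩ := exists_subset_card_eq (show n + 3 ≤ #C from hC)
  have key := five_mul_sum_card_le D E U fun i hi => hU i (hDC hi)
  obtain ⟨m, rfl⟩ : ∃ m, n = m + 2 := ⟨n - 2, by omega⟩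
  have hm : ∀ i ∈ D, #(E i) = m := fun i hi => by have := hcard i (hDC hi); omega
  have hle : ∀ i ∈ D, ∑ j ∈ D, #(E i ∩ E j) ≤ m + (m + 4) := fun i hi => by
    rw [← add_sum_erase _ _ hi, inter_self, hm i hi]
    gcongr
    refine (sum_le_card_nsmul _ _ 1 fun j hj => ?_).trans ?_
    · exact hinter i (hDC hi) j (hDC (mem_of_mem_erase hj)) (ne_of_mem_erase hj).symm
    · simp [card_erase_of_mem hi, hD]
  have hsum := sum_le_card_nsmul _ _ _ hle
  rw [sum_congr rfl hm, sum_const] at key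
  simp only [smul_eq_mul, hD] at key hsum
  rw [show m + 2 - 1 = m + 1 by omega] at hUcard
  nlinarith

open Finset in
/-- A family of `(n - 1)`-sets in a universe of size `n (n - 1) / 2`
that pairwise meet in at most two points has at most `n (n + 2) / 2` members. -/
theorem two_mul_card_le_of_pairwise_card_inter_le_two {ι β : Type*} [DecidableEq β] {n : ℕ}
    (hn : 13 ≤ n) (C : Finset ι) (E : ι → Finset β) (U : Finset β) (hU : ∀ i ∈ C, E i ⊆ U)
    (hcard : ∀ i ∈ C, #(E i) + 1 = n) (hUcard : 2 * #U = n * (n - 1))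
    (hinter : ∀ i ∈ C, ∀ j ∈ C, i ≠ j → #(E i ∩ E j) ≤ 2) :
    2 * #C ≤ n * (n + 2) := by
  have hdeg : ∀ e ∈ U, #{i ∈ C | e ∈ E i} ≤ n + 2 := fun e he => by
    refine card_le_of_pairwise_card_inter_le_one hn _ (fun i => (E i).erase e) (U.erase e)
      (fun i hi => erase_subset_erase e (hU i (mem_filter.1 hi).1)) (fun i hi => ?_) ?_
      (fun i hi j hj hij => ?_)
    · have := hcard i (mem_filter.1 hi).1
      have := card_erase_add_one (mem_filter.1 hi).2
      omega
    · rw [card_erase_add_one he, hUcard]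
    · rw [mem_filter] at hi hj
      have h := hinter i hi.1 j hj.1 hij
      rw [erase_inter, inter_erase, erase_idem,
        card_erase_of_mem (mem_inter.2 ⟨hi.2, hj.2⟩)]
      omega
  have h2 := sum_le_card_nsmul _ _ _ hdeg
  have hk : ∀ i ∈ C, #(E i) = n - 1 := fun i hi => by have := hcard i hi; omega
  rw [sum_card_filter_mem C E U hU, sum_congr rfl hk, sum_const, smul_eq_mul, smul_eq_mul] at h2
  refine Nat.le_of_mul_le_mul_right ?_ (show 0 < n - 1 by omega)
  calc 2 * #C * (n - 1) ≤ 2 * #U * (n + 2) := by linarith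
    _ = n * (n + 2) * (n - 1) := by rw [hUcard]; ring

theorem IsTreeCode.two_mul_card_le {n : ℕ} (hn : 13 ≤ n) {C : Finset (SimpleGraph (Fin n))}
    (hC : IsTreeCode n (n - 3) C) : 2 * C.card ≤ n * (n + 2) := by
  classical
  refine two_mul_card_le_of_pairwise_card_inter_le_two hn C (fun G => G.edgeFinset)
    (⊤ : SimpleGraph (Fin n)).edgeFinset (fun G _ => SimpleGraph.edgeFinset_mono le_top)
    (fun G hG => ?_) ?_ (fun G hG H hH hGH => ?_)
  · simpa using (hC.1 G hG).card_edgeFinset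
  · rw [SimpleGraph.card_edgeFinset_top_eq_card_choose_two, Fintype.card_fin,
      Nat.choose_two_right, Nat.mul_div_cancel' (Nat.even_mul_pred_self n).two_dvd]
  · have h := hC.2 G hG H hH hGH
    rw [treeDist, ← SimpleGraph.coe_edgeFinset, ← SimpleGraph.coe_edgeFinset,
      ← Finset.coe_inter, Set.ncard_coe_finset] at h
    omega

theorem stmt11 (n : ℕ) (hn : 13 ≤ n) :
    (A n (n - 3) : ℝ) ≤ (n : ℝ) * ((n : ℝ) + 2) / 2 := by
  have h : A n (n - 3) ≤ n * (n + 2) / 2 := by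
    refine csSup_le' ?_
    rintro m ⟨C, hC, rfl⟩
    have := hC.two_mul_card_le hn
    omega
  have h2 : A n (n - 3) * 2 ≤ n * (n + 2) := by omega
  rw [le_div_iff₀ two_pos]
  exact_mod_cast h2
end

section
/- For all integers n ≥ 35, A(n, n−4) ≤ (n³ + 5n² + 6n + 12)/4. -/
open Finset in
/-- A second-moment bound for families of `w`-sets that pairwise meet in at most one point:
the point degrees `r` are integers, so `(r - 2) * (r - 3)` is nonnegative. -/
theorem four_mul_card_mul_le_of_card_inter_le_one {ι α : Type*} [DecidableEq ι] [DecidableEq α]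
    (I : Finset ι) (B : ι → Finset α) (U : Finset α) (w : ℕ)
    (hU : ∀ i ∈ I, B i ⊆ U) (hw : ∀ i ∈ I, #(B i) = w)
    (hB : ∀ i ∈ I, ∀ j ∈ I, i ≠ j → #(B i ∩ B j) ≤ 1) :
    4 * ((#I : ℤ) * w) ≤ #I * (#I - 1) + 6 * #U := by
  let r : α → ℤ := fun x ↦ ∑ i ∈ I, if x ∈ B i then 1 else 0
  have h_deg : ∑ x ∈ U, r x = #I * w := by
    rw [sum_comm, ← nsmul_eq_mul, ← sum_const]
    refine sum_congr rfl fun i hi ↦ ?_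
    rw [sum_boole, filter_mem_eq_inter, inter_eq_right.mpr (hU i hi), hw i hi]
  have h_sq : ∑ x ∈ U, r x ^ 2 = ∑ i ∈ I, ∑ j ∈ I, (#(B i ∩ B j) : ℤ) := by
    simp only [r, sq, sum_mul_sum]
    rw [sum_comm]
    refine sum_congr rfl fun i hi ↦ ?_
    rw [sum_comm]
    refine sum_congr rfl fun j _ ↦ ?_
    simp only [ite_zero_mul_ite_zero, mul_one, ← mem_inter]
    rw [sum_boole, filter_mem_eq_inter,
      inter_eq_right.mpr (inter_subset_left.trans (hU i hi))]
  have h_pairs : ∑ i ∈ I, ∑ j ∈ I, (#(B i ∩ B j) : ℤ) ≤ #I * (w + (#I - 1)) := by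
    rw [← nsmul_eq_mul]
    refine sum_le_card_nsmul _ _ _ fun i hi ↦ ?_
    rw [← add_sum_erase _ _ hi, inter_self, hw i hi, ← cast_card_erase_of_mem hi]
    refine add_le_add_right ?_ _
    rw [← nsmul_one]
    refine sum_le_card_nsmul _ _ _ fun j hj ↦ ?_
    exact_mod_cast hB i hi j (mem_of_mem_erase hj) (ne_of_mem_erase hj).symm
  have h_nonneg : 0 ≤ ∑ x ∈ U, (r x ^ 2 - 5 * r x + 6) := by
    refine sum_nonneg fun x _ ↦ ?_
    rcases le_or_gt (r x) 2 with h | h <;> nlinarith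
  rw [sum_add_distrib, sum_sub_distrib, ← mul_sum, h_deg, h_sq, sum_const, nsmul_eq_mul]
    at h_nonneg
  linarith

open Finset in
/-- At most `n + 4` sets of size `n - 1` contain two given points of an `n.choose 2`-set,
if they pairwise meet in at most three points. -/
theorem card_le_add_four_of_pair_mem {ι α : Type*} [DecidableEq ι] [DecidableEq α]
    {n : ℕ} (hn : 35 ≤ n) (I : Finset ι) (B : ι → Finset α) (U : Finset α)
    (hcard : #U = n.choose 2) (hU : ∀ i ∈ I, B i ⊆ U) (hw : ∀ i ∈ I, #(B i) + 1 = n)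
    (hB : ∀ i ∈ I, ∀ j ∈ I, i ≠ j → #(B i ∩ B j) ≤ 3)
    {a b : α} (hab : a ≠ b) (ha : ∀ i ∈ I, a ∈ B i) (hb : ∀ i ∈ I, b ∈ B i) :
    #I ≤ n + 4 := by
  by_contra! hlt
  obtain ⟨J, hJI, hJ⟩ := exists_subset_card_eq (show n + 5 ≤ #I by omega)
  obtain ⟨i, hi⟩ : J.Nonempty := card_pos.mp (by omega)
  have h_sub : ∀ s : Finset α, a ∈ s → b ∈ s → #(s \ {a, b}) = #s - 2 := fun s has hbs ↦ by
    rw [card_sdiff_of_subset (by simp [insert_subset_iff, has, hbs]), card_pair hab]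
  have key := four_mul_card_mul_le_of_card_inter_le_one J (fun i ↦ B i \ {a, b})
    (U \ {a, b}) (n - 3) (fun i hi ↦ sdiff_subset_sdiff (hU i (hJI hi)) le_rfl)
    (fun i hi ↦ by
      have := hw i (hJI hi)
      rw [h_sub _ (ha i (hJI hi)) (hb i (hJI hi))]
      omega)
    (fun i hi j hj hij ↦ by
      have := hB i (hJI hi) j (hJI hj) hij
      rw [← inf_eq_inter, ← inf_sdiff, inf_eq_inter, h_sub _ (mem_inter.mpr ⟨ha i (hJI hi), ha j (hJI hj)⟩)
        (mem_inter.mpr ⟨hb i (hJI hi), hb j (hJI hj)⟩)]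
      omega)
  rw [h_sub U (hU i (hJI hi) (ha i (hJI hi))) (hU i (hJI hi) (hb i (hJI hi))), hcard, hJ] at key
  have h_choose : 2 * n.choose 2 = n * (n - 1) := by
    rw [Nat.choose_two_right, Nat.mul_div_cancel' n.even_mul_pred_self.two_dvd]
  have h_two : 2 ≤ n.choose 2 := by nlinarith [show 34 ≤ n - 1 by omega]
  zify [h_two, show 3 ≤ n by omega, show 1 ≤ n by omega] at key h_choose hn
  nlinarith

open Finset in
/-- A family of `(n - 1)`-subsets of an `n.choose 2`-set pairwise meeting in at most three points
has at most `n * (n + 1) * (n + 4) / 4` members. -/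
theorem four_mul_card_le_of_card_inter_le_three {ι α : Type*} [DecidableEq ι] [DecidableEq α]
    {n : ℕ} (hn : 35 ≤ n) (I : Finset ι) (B : ι → Finset α) (U : Finset α)
    (hcard : #U = n.choose 2) (hU : ∀ i ∈ I, B i ⊆ U) (hw : ∀ i ∈ I, #(B i) + 1 = n)
    (hB : ∀ i ∈ I, ∀ j ∈ I, i ≠ j → #(B i ∩ B j) ≤ 3) :
    4 * #I ≤ n * (n + 1) * (n + 4) := by
  have h_count : #I * ((n - 1) * (n - 1) - (n - 1)) ≤ #U.offDiag * (n + 4) := by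
    refine card_mul_le_card_mul (fun i p ↦ p ∈ (B i).offDiag) (fun i hi ↦ ?_) fun p hp ↦ ?_
    · rw [bipartiteAbove, filter_mem_eq_inter, inter_eq_right.mpr (offDiag_mono (hU i hi)),
        offDiag_card, show #(B i) = n - 1 by have := hw i hi; omega]
    · refine card_le_add_four_of_pair_mem hn _ B U hcard (a := p.1) (b := p.2)
        (fun i hi ↦ hU i (mem_of_mem_filter i hi)) (fun i hi ↦ hw i (mem_of_mem_filter i hi))
        (fun i hi j hj ↦ hB i (mem_of_mem_filter i hi) j (mem_of_mem_filter j hj))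
        (mem_offDiag.mp hp).2.2 (fun i hi ↦ ?_) fun i hi ↦ ?_
      · exact (mem_offDiag.mp (mem_filter.mp hi).2).1
      · exact (mem_offDiag.mp (mem_filter.mp hi).2).2.1
  have h_choose : 2 * n.choose 2 = n * (n - 1) := by
    rw [Nat.choose_two_right, Nat.mul_div_cancel' n.even_mul_pred_self.two_dvd]
  rw [offDiag_card, hcard] at h_count
  zify [Nat.le_mul_self, show 1 ≤ n by omega] at h_count h_choose hn ⊢
  have h_pos : (0 : ℤ) < (n - 1) * (n - 2) := by nlinarith
  refine le_of_mul_le_mul_right ?_ h_pos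
  calc 4 * (#I : ℤ) * ((n - 1) * (n - 2))
      = 4 * (#I * ((n - 1) * (n - 1) - (n - 1))) := by ring
    _ ≤ 4 * ((n.choose 2 * n.choose 2 - n.choose 2) * (n + 4)) := by gcongr
    _ = (2 * n.choose 2) * (2 * n.choose 2 - 2) * (n + 4) := by ring
    _ = n * (n + 1) * (n + 4) * ((n - 1) * (n - 2)) := by rw [h_choose]; ring

/-- Any `(n, n - 4)` tree-code with `35 ≤ n` has at most `n * (n + 1) * (n + 4) / 4` members. -/
theorem IsTreeCode.four_mul_card_le {n : ℕ} (hn : 35 ≤ n) {C : Finset (SimpleGraph (Fin n))}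
    (hC : IsTreeCode n (n - 4) C) : 4 * C.card ≤ n * (n + 1) * (n + 4) := by
  classical
  refine four_mul_card_le_of_card_inter_le_three hn C (fun G ↦ G.edgeFinset)
    (⊤ : SimpleGraph (Fin n)).edgeFinset ?_ (fun G _ ↦ ?_) (fun G hG ↦ ?_)
    fun G hG H hH hGH ↦ ?_
  · rw [SimpleGraph.card_edgeFinset_top_eq_card_choose_two, Fintype.card_fin]
  · exact SimpleGraph.edgeFinset_mono le_top
  · rw [(hC.1 G hG).card_edgeFinset, Fintype.card_fin]
  · have h_dist := hC.2 G hG H hH hGH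
    have h_ncard : (G.edgeSet ∩ H.edgeSet).ncard = (G.edgeFinset ∩ H.edgeFinset).card := by
      rw [← Set.ncard_coe_finset, Finset.coe_inter, SimpleGraph.coe_edgeFinset,
        SimpleGraph.coe_edgeFinset]
    rw [treeDist, h_ncard] at h_dist
    omega

theorem stmt12 (n : ℕ) (hn : 35 ≤ n) :
    (A n (n - 4) : ℝ) ≤ ((n : ℝ) ^ 3 + 5 * (n : ℝ) ^ 2 + 6 * (n : ℝ) + 12) / 4 := by
  have h_le : A n (n - 4) ≤ n * (n + 1) * (n + 4) / 4 := by
    refine csSup_le ⟨0, ∅, by simp [IsTreeCode], rfl⟩ ?_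
    rintro m ⟨C, hC, rfl⟩
    have := hC.four_mul_card_le hn
    omega
  have h_real : (4 * A n (n - 4) : ℝ) ≤ n * (n + 1) * (n + 4) := by
    exact_mod_cast (show 4 * A n (n - 4) ≤ n * (n + 1) * (n + 4) by omega)
  have h_nonneg : (0 : ℝ) ≤ n := n.cast_nonneg
  linarith
end

section
/- For all integers n > d ≥ 1, A(n,d) ≥ d^d · n^(n−2d) / C(n−1, d−1). Moreover, if in addition d > n/2, then A(n,d) ≥ (n/2)^(n−d) / C(n−1, d−1). -/
open Finset SimpleGraph

section Fibers

variable {V : Type*} [Fintype V] [DecidableEq V]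

/-- The size of the fibre of `r` over `x`. -/
def fiberCard (r : V → V) (x : V) : ℕ := #{w | r w = x}

/-- The product of the sizes of the nonempty fibres of `r`. -/
def fiberProd (r : V → V) : ℕ := ∏ x ∈ univ.image r, fiberCard r x

/-- Merge the fibre of `a` into the fibre of `b`. -/
def mergeFibers (r : V → V) (a b : V) (w : V) : V := if r w = r a then r b else r w

lemma fiberCard_pos (r : V → V) (v : V) : 0 < fiberCard r (r v) :=
  card_pos.2 ⟨v, by simp⟩

lemma sum_fiberCard (r : V → V) : ∑ x ∈ univ.image r, fiberCard r x = Fintype.card V :=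
  (card_eq_sum_card_image r univ).symm

lemma image_mergeFibers {r : V → V} {a b : V} (h : r a ≠ r b) :
    univ.image (mergeFibers r a b) = (univ.image r).erase (r a) := by
  ext x
  simp only [mem_image, mem_univ, true_and, mem_erase, mergeFibers]
  constructor
  · rintro ⟨w, rfl⟩
    split_ifs with hw
    · exact ⟨h.symm, b, rfl⟩
    · exact ⟨hw, w, rfl⟩
  · rintro ⟨hx, w, rfl⟩
    exact ⟨w, if_neg hx⟩

lemma card_image_mergeFibers {r : V → V} {a b : V} (h : r a ≠ r b) :
    #(univ.image (mergeFibers r a b)) + 1 = #(univ.image r) := by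
  rw [image_mergeFibers h]
  exact card_erase_add_one (mem_image_of_mem r (mem_univ a))

lemma fiberCard_mergeFibers_self {r : V → V} {a b : V} (h : r a ≠ r b) :
    fiberCard (mergeFibers r a b) (r b) = fiberCard r (r a) + fiberCard r (r b) := by
  unfold fiberCard
  rw [← card_union_of_disjoint]
  · congr 1
    ext w
    simp only [mem_filter, mem_univ, true_and, mem_union]
    unfold mergeFibers
    split_ifs with hw <;> simp [hw]
  · rw [disjoint_filter]
    intro w _ h₁ h₂
    exact h (h₁.symm.trans h₂)

lemma fiberCard_mergeFibers_of_ne {r : V → V} {a b x : V} (ha : x ≠ r a) (hb : x ≠ r b) :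
    fiberCard (mergeFibers r a b) x = fiberCard r x := by
  unfold fiberCard
  congr 1
  ext w
  simp only [mem_filter, mem_univ, true_and]
  unfold mergeFibers
  split_ifs with hw
  · simp [hw, ha.symm, hb.symm]
  · rfl

lemma fiberProd_mergeFibers {r : V → V} {a b : V} (h : r a ≠ r b) :
    fiberProd (mergeFibers r a b) * (fiberCard r (r a) * fiberCard r (r b)) =
      fiberProd r * (fiberCard r (r a) + fiberCard r (r b)) := by
  have ha : r a ∈ univ.image r := mem_image_of_mem r (mem_univ a)
  have hb : r b ∈ (univ.image r).erase (r a) :=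
    mem_erase.2 ⟨h.symm, mem_image_of_mem r (mem_univ b)⟩
  unfold fiberProd
  rw [image_mergeFibers h, ← mul_prod_erase _ _ ha, ← mul_prod_erase _ _ hb,
    ← mul_prod_erase _ _ hb, fiberCard_mergeFibers_self h,
    prod_congr rfl fun x hx ↦ fiberCard_mergeFibers_of_ne
      (mem_erase.1 (mem_erase.1 hx).2).1 (mem_erase.1 hx).1]
  ring

lemma sum_inv_fiberCard (r : V → V) :
    ∑ v, (fiberCard r (r v) : ℝ)⁻¹ = #(univ.image r) := by
  rw [sum_comp (fun x ↦ (fiberCard r x : ℝ)⁻¹) r, card_eq_sum_ones, Nat.cast_sum]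
  refine sum_congr rfl fun x hx ↦ ?_
  obtain ⟨v, -, rfl⟩ := mem_image.1 hx
  have := (fiberCard_pos r v).ne'
  change fiberCard r (r v) • _ = _
  simp [this]

/-- Summing `1 / s(a) + 1 / s(b)` over the ordered pairs `(a, b)` in distinct fibres. -/
lemma sum_pairs_inv_fiberCard (r : V → V) :
    ∑ p : V × V with r p.1 ≠ r p.2,
      ((fiberCard r (r p.1) : ℝ)⁻¹ + (fiberCard r (r p.2) : ℝ)⁻¹) =
      2 * Fintype.card V * (#(univ.image r) - 1) := by
  have key : ∑ a, ∑ b, (if r a ≠ r b then (fiberCard r (r a) : ℝ)⁻¹ else 0) =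
      Fintype.card V * (#(univ.image r) - 1) := by
    have inner (a : V) : ∑ b, (if r a ≠ r b then (fiberCard r (r a) : ℝ)⁻¹ else 0) =
        Fintype.card V * (fiberCard r (r a) : ℝ)⁻¹ - 1 := by
      have hc : (#{b | r a ≠ r b} : ℝ) + fiberCard r (r a) = Fintype.card V := by
        rw [fiberCard, add_comm, ← Nat.cast_add]
        simp_rw [ne_comm (a := r a)]
        rw [card_filter_add_card_filter_not, card_univ]
      have := (fiberCard_pos r a).ne'
      rw [← sum_filter, sum_const, nsmul_eq_mul, ← hc]
      field_simp
      ring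
    simp_rw [inner]
    rw [sum_sub_distrib, ← mul_sum, sum_inv_fiberCard]
    simp
    ring
  have key' : ∑ b, ∑ a, (if r a ≠ r b then (fiberCard r (r b) : ℝ)⁻¹ else 0) =
      Fintype.card V * (#(univ.image r) - 1) := by
    rw [← key]
    exact sum_congr rfl fun b _ ↦ sum_congr rfl fun a _ ↦ if_congr ne_comm rfl rfl
  rw [sum_add_distrib, sum_filter, sum_filter, Fintype.sum_prod_type, Fintype.sum_prod_type_right,
    key, key']
  ring

lemma fiberProd_le_two_pow (r : V → V) :
    fiberProd r ≤ 2 ^ (Fintype.card V - #(univ.image r)) := by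
  have h : Fintype.card V - #(univ.image r) = ∑ x ∈ univ.image r, (fiberCard r x - 1) := by
    rw [← sum_fiberCard r, card_eq_sum_ones, sum_tsub_distrib]
    intro x hx
    obtain ⟨v, -, rfl⟩ := mem_image.1 hx
    exact fiberCard_pos r v
  rw [h, ← prod_pow_eq_pow_sum]
  refine prod_le_prod' fun x _ ↦ ?_
  have := Nat.lt_two_pow_self (n := fiberCard r x - 1)
  omega

lemma fiberProd_le_div_pow [Nonempty V] (r : V → V) :
    (fiberProd r : ℝ) ≤ (Fintype.card V / #(univ.image r)) ^ #(univ.image r) := by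
  have hk : 0 < #(univ.image r) := (univ_nonempty.image r).card_pos
  have h := Real.geom_mean_le_arith_mean (univ.image r) (fun _ ↦ 1) (fun x ↦ (fiberCard r x : ℝ))
    (by simp) (by simp) (by simp)
  simp only [Real.rpow_one, sum_const, nsmul_eq_mul, mul_one, one_mul] at h
  rw [← Nat.cast_sum, sum_fiberCard, ← Nat.cast_prod] at h
  have h' := pow_le_pow_left₀ (by positivity) h #(univ.image r)
  rwa [Real.rpow_inv_natCast_pow (by positivity) hk.ne'] at h'

end Fibers

section Forest

variable {V : Type*}

/-- `r` labels the vertices of `F` so that two labels agree exactly on connected components. -/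
def LabelsComponents (F : SimpleGraph V) (r : V → V) : Prop :=
  ∀ u v, r u = r v ↔ F.Reachable u v

lemma exists_labelsComponents (F : SimpleGraph V) : ∃ r, LabelsComponents F r := by
  refine ⟨fun v ↦ (F.connectedComponentMk v).out, fun u v ↦ ?_⟩
  rw [← ConnectedComponent.eq]
  exact ⟨fun h ↦ (Quot.out_eq _).symm.trans ((congrArg _ h).trans (Quot.out_eq _)),
    congrArg Quot.out⟩

lemma LabelsComponents.sup_edge [DecidableEq V] {F : SimpleGraph V} {r : V → V}
    (hr : LabelsComponents F r) {a b : V} (hab : r a ≠ r b) :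
    LabelsComponents (F ⊔ edge a b) (mergeFibers r a b) := by
  have hadj : (F ⊔ edge a b).Reachable a b :=
    Adj.reachable (Or.inr ((edge_adj ..).2 ⟨Or.inl ⟨rfl, rfl⟩, fun h ↦ hab (h ▸ rfl)⟩))
  have hmono {u v : V} (h : r u = r v) : (F ⊔ edge a b).Reachable u v :=
    ((hr u v).1 h).mono le_sup_left
  intro u v
  constructor
  · unfold mergeFibers
    split_ifs with hu hv hv
    · exact fun _ ↦ hmono (hu.trans hv.symm)
    · exact fun h ↦ (hmono hu).trans (hadj.trans (hmono h))
    · exact fun h ↦ (hmono h).trans (hadj.symm.trans (hmono hv.symm))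
    · exact hmono
  · rintro ⟨w⟩
    induction w with
    | nil => rfl
    | cons h _ ih =>
      refine Eq.trans ?_ ih
      rcases h with h | h
      · simp only [mergeFibers, (hr _ _).2 h.reachable]
      · rcases ((edge_adj ..).1 h).1 with ⟨rfl, rfl⟩ | ⟨rfl, rfl⟩ <;> simp [mergeFibers]

variable [Fintype V]

lemma LabelsComponents.isTree [DecidableEq V] {F : SimpleGraph V} {r : V → V}
    (hr : LabelsComponents F r) (hF : F.IsAcyclic) (hk : #(univ.image r) = 1) : F.IsTree := by
  obtain ⟨x, hx⟩ := card_eq_one.1 hk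
  have hc (v : V) : r v = x := mem_singleton.1 (hx ▸ mem_image_of_mem r (mem_univ v))
  obtain ⟨v, -⟩ := mem_image.1 (hx ▸ mem_singleton_self x : x ∈ univ.image r)
  have : Nonempty V := ⟨v⟩
  exact ⟨⟨fun u v ↦ (hr u v).1 ((hc u).trans (hc v).symm)⟩, hF⟩

lemma ncard_edgeSet_add_one_of_isTree {T : SimpleGraph V} (hT : T.IsTree) :
    T.edgeSet.ncard + 1 = Fintype.card V := by
  rw [← Nat.card_coe_set_eq, (isTree_iff_connected_and_card.1 hT).2, Nat.card_eq_fintype_card]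

lemma LabelsComponents.ncard_edgeSet_add_card [DecidableEq V] [Nonempty V] {F : SimpleGraph V}
    {r : V → V} (hr : LabelsComponents F r) (hF : F.IsAcyclic) :
    F.edgeSet.ncard + #(univ.image r) = Fintype.card V := by
  obtain ⟨k, hk⟩ : ∃ k, #(univ.image r) = k + 1 :=
    Nat.exists_eq_succ_of_ne_zero (univ_nonempty.image r).card_pos.ne'
  induction k generalizing F r with
  | zero => rw [hk]; exact ncard_edgeSet_add_one_of_isTree (hr.isTree hF hk)
  | succ k ih =>
    obtain ⟨x, hx, y, hy, hxy⟩ := one_lt_card.1 (show 1 < #(univ.image r) by omega)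
    obtain ⟨a, -, rfl⟩ := mem_image.1 hx
    obtain ⟨b, -, rfl⟩ := mem_image.1 hy
    have hreach : ¬ F.Reachable a b := fun h ↦ hxy ((hr a b).2 h)
    have hcard := card_image_mergeFibers hxy
    have h := ih (hr.sup_edge hxy) (hF.sup_edge_of_not_reachable hreach) (by omega)
    have hne : a ≠ b := fun h ↦ hxy (h ▸ rfl)
    have hE : (F ⊔ edge a b).edgeSet.ncard = F.edgeSet.ncard + 1 := by
      rw [edgeSet_sup, edgeSet_edge_of_ne hne, Set.union_singleton,
        Set.ncard_insert_of_notMem fun h : s(a, b) ∈ F.edgeSet ↦ hreach (Adj.reachable h)]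
    omega

/-- The spanning trees containing a given graph. -/
noncomputable def treesAbove (F : SimpleGraph V) : Finset (SimpleGraph V) :=
  (Set.toFinite {T : SimpleGraph V | T.IsTree ∧ F ≤ T}).toFinset

@[simp] lemma mem_treesAbove {F T : SimpleGraph V} : T ∈ treesAbove F ↔ T.IsTree ∧ F ≤ T := by
  simp [treesAbove]

lemma treesAbove_of_isTree {F : SimpleGraph V} (hF : F.IsTree) : treesAbove F = {F} := by
  ext T
  rw [mem_treesAbove, mem_singleton]
  constructor
  · rintro ⟨hT, hle⟩
    exact ((isTree_iff_minimal_connected.1 hT).eq_of_le hF.connected hle).symm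
  · rintro rfl
    exact ⟨hF, le_rfl⟩

/-- A spanning tree containing a forest with `k` components has `k - 1` further edges, which are
counted here with both orientations. -/
lemma LabelsComponents.card_adj_ne [DecidableEq V] {F T : SimpleGraph V} {r : V → V}
    [DecidableRel T.Adj] (hr : LabelsComponents F r) (hT : T.IsTree) (hle : F ≤ T) :
    #{p : V × V | T.Adj p.1 p.2 ∧ r p.1 ≠ r p.2} + 2 = 2 * #(univ.image r) := by
  classical
  have := hT.nonempty
  have hF := hT.isAcyclic.anti hle
  have hEF := hr.ncard_edgeSet_add_card hF
  have hET := ncard_edgeSet_add_one_of_isTree hT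
  have key : (univ.filter fun p : V × V ↦ F.Adj p.1 p.2) =
      univ.filter fun p : V × V ↦ T.Adj p.1 p.2 ∧ ¬ r p.1 ≠ r p.2 := by
    ext ⟨a, b⟩
    simp only [mem_filter, mem_univ, true_and, not_not, hr a b]
    constructor
    · exact fun h ↦ ⟨hle h, h.reachable⟩
    · rintro ⟨h, hreach⟩
      have hac := hT.isAcyclic.anti (sup_le hle ((edge_le_iff _).2 (Or.inr h)))
      exact ((isAcyclic_sup_fromEdgeSet_iff.1 hac).2 hreach).resolve_left h.ne
  have h₁ : 2 * #F.edgeSet.toFinset = #{p : V × V | F.Adj p.1 p.2} :=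
    F.two_mul_card_edgeFinset
  have h₂ : 2 * #T.edgeSet.toFinset = #{p : V × V | T.Adj p.1 p.2} :=
    T.two_mul_card_edgeFinset
  have h₃ := card_filter_add_card_filter_not (s := univ.filter fun p : V × V ↦ T.Adj p.1 p.2)
    (fun p ↦ r p.1 ≠ r p.2)
  rw [filter_filter, filter_filter, ← key] at h₃
  rw [Set.ncard_eq_toFinset_card'] at hEF hET
  omega

lemma LabelsComponents.sum_card_treesAbove_sup_edge [DecidableEq V] {F : SimpleGraph V}
    {r : V → V} (hr : LabelsComponents F r) :
    ∑ p : V × V with r p.1 ≠ r p.2, (#(treesAbove (F ⊔ edge p.1 p.2)) : ℝ) =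
      #(treesAbove F) * (2 * (#(univ.image r) - 1)) := by
  classical
  have hfil {p : V × V} (hp : r p.1 ≠ r p.2) :
      treesAbove (F ⊔ edge p.1 p.2) = (treesAbove F).filter fun T ↦ T.Adj p.1 p.2 := by
    ext T
    have hne : p.1 ≠ p.2 := fun h ↦ hp (h ▸ rfl)
    simp [hne, and_assoc]
  have hcount := sum_card_bipartiteAbove_eq_sum_card_bipartiteBelow
    (s := univ.filter fun p : V × V ↦ r p.1 ≠ r p.2) (t := treesAbove F)
    (fun p T ↦ T.Adj p.1 p.2)
  rw [← Nat.cast_sum, sum_congr rfl fun p hp ↦ by rw [hfil (mem_filter.1 hp).2]]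
  refine (congrArg Nat.cast hcount).trans ?_
  rw [Nat.cast_sum, ← nsmul_eq_mul, ← sum_const]
  refine sum_congr rfl fun T hT ↦ ?_
  obtain ⟨hT, hle⟩ := mem_treesAbove.1 hT
  have h := hr.card_adj_ne hT hle
  have h' : #(bipartiteBelow (fun p T ↦ T.Adj p.1 p.2) {p : V × V | r p.1 ≠ r p.2} T) + 2 =
      2 * #(univ.image r) := by
    rw [← h, bipartiteBelow, filter_filter]
    simp_rw [and_comm]
  have h'' := congrArg (Nat.cast (R := ℝ)) h'
  push_cast at h''
  linarith

/-- The number of spanning trees of the complete graph on `n` vertices that contain a given forest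
with `k` components is `n ^ (k - 2)` times the product of the component sizes. -/
theorem LabelsComponents.card_treesAbove [DecidableEq V] [Nonempty V] {F : SimpleGraph V}
    {r : V → V} (hr : LabelsComponents F r) (hF : F.IsAcyclic) :
    (Fintype.card V : ℝ) ^ 2 * #(treesAbove F) =
      (Fintype.card V : ℝ) ^ #(univ.image r) * fiberProd r := by
  obtain ⟨k, hk⟩ : ∃ k, #(univ.image r) = k + 1 :=
    Nat.exists_eq_succ_of_ne_zero (univ_nonempty.image r).card_pos.ne'
  induction k generalizing F r with
  | zero =>
    obtain ⟨x, hx⟩ := card_eq_one.1 hk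
    have hs := sum_fiberCard r
    have hP : fiberProd r = Fintype.card V := by
      rw [← hs, fiberProd, hx, sum_singleton, prod_singleton]
    rw [treesAbove_of_isTree (hr.isTree hF hk), hP, hk, card_singleton]
    ring
  | succ k ih =>
    have hstep (p : V × V) (hp : r p.1 ≠ r p.2) :
        (Fintype.card V : ℝ) ^ 2 * #(treesAbove (F ⊔ edge p.1 p.2)) =
          (Fintype.card V : ℝ) ^ (k + 1) * fiberProd r *
            ((fiberCard r (r p.1) : ℝ)⁻¹ + (fiberCard r (r p.2) : ℝ)⁻¹) := by
      have hcard := card_image_mergeFibers hp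
      have hk' : #(univ.image (mergeFibers r p.1 p.2)) = k + 1 := by omega
      rw [ih (hr.sup_edge hp)
        (hF.sup_edge_of_not_reachable fun h ↦ hp ((hr _ _).2 h)) hk', hk', mul_assoc]
      congr 1
      have h₁ := (fiberCard_pos r p.1).ne'
      have h₂ := (fiberCard_pos r p.2).ne'
      have h := congrArg (Nat.cast (R := ℝ)) (fiberProd_mergeFibers hp)
      push_cast at h
      field_simp
      linarith
    have hsum := hr.sum_card_treesAbove_sup_edge
    have hcount := congrArg ((Fintype.card V : ℝ) ^ 2 * ·) hsum
    simp only [mul_sum] at hcount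
    rw [sum_congr rfl fun p hp ↦ hstep p (mem_filter.1 hp).2, ← mul_sum,
      sum_pairs_inv_fiberCard, hk] at hcount
    rw [hk]
    have hpos : (0 : ℝ) < 2 * ((k + 1 + 1 : ℕ) - 1) := by
      push_cast
      linarith [k.cast_nonneg (α := ℝ)]
    refine mul_right_cancel₀ hpos.ne' ?_
    rw [mul_assoc _ _ (2 * _), ← hcount]
    ring

end Forest

section TreeCode

variable {n d : ℕ}

lemma card_treesAbove_bot [NeZero n] :
    (n : ℝ) ^ 2 * #(treesAbove (⊥ : SimpleGraph (Fin n))) = (n : ℝ) ^ n := by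
  have hr : LabelsComponents (⊥ : SimpleGraph (Fin n)) id := fun u v ↦ by simp
  have h := hr.card_treesAbove isAcyclic_bot
  have hP : fiberProd (id : Fin n → Fin n) = 1 := by
    simp [fiberProd, fiberCard, filter_eq']
  simpa [hP] using h

/-- The spanning trees at tree-distance less than `d` from `G`. -/
noncomputable def treeBall (d : ℕ) (G : SimpleGraph (Fin n)) : Finset (SimpleGraph (Fin n)) :=
  (Set.toFinite {H : SimpleGraph (Fin n) | H.IsTree ∧ treeDist G H < d}).toFinset

@[simp] lemma mem_treeBall {G H : SimpleGraph (Fin n)} :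
    H ∈ treeBall d G ↔ H.IsTree ∧ treeDist G H < d := by
  simp [treeBall]

lemma treeDist_comm (G H : SimpleGraph (Fin n)) : treeDist G H = treeDist H G := by
  rw [treeDist, treeDist, Set.inter_comm]

lemma treeDist_self {G : SimpleGraph (Fin n)} (hG : G.IsTree) : treeDist G G = 0 := by
  have h := ncard_edgeSet_add_one_of_isTree hG
  rw [Fintype.card_fin] at h
  rw [treeDist, Set.inter_self]
  omega

/-- A tree close to `G` shares `n - d` edges with it. -/
lemma card_treeBall_le (hd : d < n) {G : SimpleGraph (Fin n)} (hG : G.IsTree) {M : ℝ}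
    (hM : ∀ F : SimpleGraph (Fin n), F.IsAcyclic → F.edgeSet.ncard = n - d →
      (#(treesAbove F) : ℝ) ≤ M) :
    (#(treeBall d G) : ℝ) ≤ (n - 1).choose (n - d) * M := by
  classical
  have hE := ncard_edgeSet_add_one_of_isTree hG
  rw [Set.ncard_eq_toFinset_card', Fintype.card_fin] at hE
  have hsub : treeBall d G ⊆ (G.edgeSet.toFinset.powersetCard (n - d)).biUnion
      fun S ↦ treesAbove (fromEdgeSet (S : Set (Sym2 (Fin n)))) := by
    intro H hH
    obtain ⟨hHt, hHd⟩ := mem_treeBall.1 hH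
    have hcard : n - d ≤ #(G.edgeSet.toFinset ∩ H.edgeSet.toFinset) := by
      rw [← Set.toFinset_inter, ← Set.ncard_eq_toFinset_card']
      rw [treeDist] at hHd
      omega
    obtain ⟨S, hS, hSc⟩ := exists_subset_card_eq hcard
    refine mem_biUnion.2 ⟨S, mem_powersetCard.2 ⟨hS.trans inter_subset_left, hSc⟩,
      mem_treesAbove.2 ⟨hHt, fun u v huv ↦ ?_⟩⟩
    exact (mem_edgeSet H).1 (Set.mem_toFinset.1 (mem_inter.1 (hS ((fromEdgeSet_adj _).1 huv).1)).2)
  have hforest (S : Finset (Sym2 (Fin n))) (hS : S ∈ G.edgeSet.toFinset.powersetCard (n - d)) :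
      (#(treesAbove (fromEdgeSet (S : Set (Sym2 (Fin n))))) : ℝ) ≤ M := by
    obtain ⟨hSG, hSc⟩ := mem_powersetCard.1 hS
    have hmem {e : Sym2 (Fin n)} (he : e ∈ S) : e ∈ G.edgeSet := Set.mem_toFinset.1 (hSG he)
    refine hM _ (hG.isAcyclic.anti fun u v huv ↦ hmem ((fromEdgeSet_adj _).1 huv).1) ?_
    have hdiag : (S : Set (Sym2 (Fin n))) \ Sym2.diagSet = S :=
      sdiff_eq_left.2 (Set.disjoint_left.2 fun e he ↦ G.not_isDiag_of_mem_edgeSet (hmem he))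
    rw [edgeSet_fromEdgeSet, hdiag, Set.ncard_coe_finset, hSc]
  calc (#(treeBall d G) : ℝ)
      ≤ ∑ S ∈ G.edgeSet.toFinset.powersetCard (n - d),
          (#(treesAbove (fromEdgeSet (S : Set (Sym2 (Fin n))))) : ℝ) := by
        exact_mod_cast (card_le_card hsub).trans card_biUnion_le
    _ ≤ #(G.edgeSet.toFinset.powersetCard (n - d)) • M := sum_le_card_nsmul _ _ _ hforest
    _ = (n - 1).choose (n - d) * M := by
        rw [card_powersetCard, nsmul_eq_mul, Nat.eq_sub_of_add_eq hE]

lemma bddAbove_card_treeCode (n d : ℕ) :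
    BddAbove {m : ℕ | ∃ C : Finset (SimpleGraph (Fin n)), IsTreeCode n d C ∧ C.card = m} := by
  classical
  refine ⟨Fintype.card (SimpleGraph (Fin n)), ?_⟩
  rintro m ⟨C, -, rfl⟩
  exact card_le_univ C

/-- A code of maximal size covers all trees by balls. -/
lemma exists_treeCode_covering (hd : 1 ≤ d) :
    ∃ C : Finset (SimpleGraph (Fin n)), IsTreeCode n d C ∧ #C = A n d ∧
      ∀ H : SimpleGraph (Fin n), H.IsTree → ∃ G ∈ C, H ∈ treeBall d G := by
  classical
  obtain ⟨C, hC, hcard⟩ := Nat.sSup_mem (s := {m : ℕ | ∃ C : Finset (SimpleGraph (Fin n)),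
    IsTreeCode n d C ∧ C.card = m}) ⟨0, ∅, by simp [IsTreeCode]⟩ (bddAbove_card_treeCode n d)
  refine ⟨C, hC, hcard, fun H hH ↦ ?_⟩
  by_contra! hfar
  have hdist (G) (hG : G ∈ C) : d ≤ treeDist G H :=
    not_lt.1 fun h ↦ hfar G hG (mem_treeBall.2 ⟨hH, h⟩)
  have hnot : H ∉ C := fun h ↦ hfar H h (mem_treeBall.2 ⟨hH, by rw [treeDist_self hH]; omega⟩)
  have hcode : IsTreeCode n d (insert H C) := by
    refine ⟨forall_mem_insert _ _ _ |>.2 ⟨hH, hC.1⟩, fun G hG K hK hne ↦ ?_⟩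
    rcases mem_insert.1 hG with rfl | hGC <;> rcases mem_insert.1 hK with rfl | hKC
    · exact absurd rfl hne
    · exact treeDist_comm K G ▸ hdist K hKC
    · exact hdist G hGC
    · exact hC.2 G hGC K hKC hne
  have hle : #(insert H C) ≤ A n d :=
    le_csSup (bddAbove_card_treeCode n d) ⟨_, hcode, rfl⟩
  rw [card_insert_of_notMem hnot, hcard, A] at hle
  omega

/-- The Gilbert–Varshamov bound for tree-codes, in terms of a bound `B` for the product of the
component sizes of a forest with `d` components. -/
lemma pow_le_A_mul (hd1 : 1 ≤ d) (hd2 : d < n) {B : ℝ}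
    (hB : ∀ r : Fin n → Fin n, #(univ.image r) = d → (fiberProd r : ℝ) ≤ B) :
    (n : ℝ) ^ n ≤ A n d * ((n - 1).choose (d - 1) * ((n : ℝ) ^ d * B)) := by
  classical
  have : NeZero n := ⟨by omega⟩
  have hn0 : (0 : ℝ) < n := by exact_mod_cast (by omega : 0 < n)
  have hn : (0 : ℝ) < (n : ℝ) ^ 2 := pow_pos hn0 2
  have hM (F : SimpleGraph (Fin n)) (hF : F.IsAcyclic) (hE : F.edgeSet.ncard = n - d) :
      (#(treesAbove F) : ℝ) ≤ (n : ℝ) ^ d * B / (n : ℝ) ^ 2 := by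
    obtain ⟨r, hr⟩ := exists_labelsComponents F
    have hk := hr.ncard_edgeSet_add_card hF
    have hcard := hr.card_treesAbove hF
    rw [Fintype.card_fin] at hk hcard
    have hkd : #(univ.image r) = d := by omega
    rw [hkd] at hcard
    rw [le_div_iff₀ hn, mul_comm, hcard]
    exact mul_le_mul_of_nonneg_left (hB r hkd) (by positivity)
  obtain ⟨C, hC, hcard, hcov⟩ := exists_treeCode_covering (n := n) hd1
  have hsub : treesAbove (⊥ : SimpleGraph (Fin n)) ⊆ C.biUnion (treeBall d) := fun H hH ↦
    mem_biUnion.2 (hcov H (mem_treesAbove.1 hH).1)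
  have hchoose : (n - 1).choose (n - d) = (n - 1).choose (d - 1) :=
    Nat.choose_symm_of_eq_add (by omega)
  calc (n : ℝ) ^ n = (n : ℝ) ^ 2 * #(treesAbove (⊥ : SimpleGraph (Fin n))) :=
        card_treesAbove_bot.symm
    _ ≤ (n : ℝ) ^ 2 * ∑ G ∈ C, (#(treeBall d G) : ℝ) := by
        refine mul_le_mul_of_nonneg_left ?_ hn.le
        exact_mod_cast (card_le_card hsub).trans card_biUnion_le
    _ ≤ (n : ℝ) ^ 2 * (#C • ((n - 1).choose (n - d) * ((n : ℝ) ^ d * B / (n : ℝ) ^ 2))) :=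
        mul_le_mul_of_nonneg_left
          (sum_le_card_nsmul _ _ _ fun G hG ↦ card_treeBall_le hd2 (hC.1 G hG) hM) hn.le
    _ = A n d * ((n - 1).choose (d - 1) * ((n : ℝ) ^ d * B)) := by
        rw [hcard, hchoose, nsmul_eq_mul]
        field_simp

end TreeCode

theorem stmt14 (n d : ℕ) (hd1 : 1 ≤ d) (hd2 : d < n) :
    ((d : ℝ) ^ d * (n : ℝ) ^ ((n : ℤ) - 2 * d) / (((n - 1).choose (d - 1) : ℕ) : ℝ)
        ≤ (A n d : ℝ)) ∧
      (n < 2 * d →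
        ((n : ℝ) / 2) ^ (n - d) / (((n - 1).choose (d - 1) : ℕ) : ℝ) ≤ (A n d : ℝ)) := by
  have : NeZero n := ⟨by omega⟩
  have hn : (0 : ℝ) < n := by exact_mod_cast (by omega : 0 < n)
  have hd : (0 : ℝ) < d := by exact_mod_cast hd1
  have hc : (0 : ℝ) < ((n - 1).choose (d - 1) : ℕ) := by
    exact_mod_cast Nat.choose_pos (by omega)
  constructor
  · have h := pow_le_A_mul hd1 hd2 (B := (n / d : ℝ) ^ d) fun r hr ↦ by
      simpa [hr] using fiberProd_le_div_pow r
    have hz : (n : ℝ) ^ ((n : ℤ) - 2 * d) = (n : ℝ) ^ n / ((n : ℝ) ^ d * (n : ℝ) ^ d) := by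
      rw [zpow_sub₀ hn.ne', zpow_natCast, two_mul, zpow_add₀ hn.ne', zpow_natCast]
    rw [div_pow] at h
    rw [hz, div_le_iff₀ hc, ← mul_div_assoc, div_le_iff₀ (by positivity)]
    calc (d : ℝ) ^ d * (n : ℝ) ^ n
        ≤ (d : ℝ) ^ d * (A n d * ((n - 1).choose (d - 1) *
            ((n : ℝ) ^ d * ((n : ℝ) ^ d / (d : ℝ) ^ d)))) := by gcongr
      _ = _ := by field_simp
  · intro _
    have h := pow_le_A_mul hd1 hd2 (B := (2 : ℝ) ^ (n - d)) fun r hr ↦ by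
      have h := fiberProd_le_two_pow r
      rw [hr, Fintype.card_fin] at h
      exact_mod_cast h
    rw [div_le_iff₀ hc, div_pow, div_le_iff₀ (by positivity)]
    refine le_of_mul_le_mul_right ?_ (pow_pos hn d)
    rw [← pow_add, Nat.sub_add_cancel hd2.le]
    linarith
end
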